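/- arXiv:1312.2247 — 5 statements merged into one kernel-verified Lean document; each statement's English description precedes it below -/
import Mathlib

section
/- Let k ≥ 1 and let G be a connected noncomplete k-regular finite simple graph on n vertices, and let λ = max(|λ_2(G)|, |λ_n(G)|). Then every disconnecting set S of G satisfies |S|/c(G − S) > (1/3)·(k²/(kλ + λ²) − 1); in particular t(G) > (1/3)·(k²/(kλ + λ²) − 1). -/
open SimpleGraph Matrix

/-- The list of adjacency-matrix eigenvalues of `G`, with multiplicity,
listed in decreasing order. -/
noncomputable def adjEigs {V : Type} [Fintype V] [DecidableEq V] (G : SimpleGraph V) :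
    List ℝ := by
  classical
  exact ((Finset.univ.val.map
      (Matrix.IsHermitian.eigenvalues
        (show (G.adjMatrix ℝ)ᴴ = G.adjMatrix ℝ by
          rw [Matrix.conjTranspose_eq_transpose_of_trivial]
          exact G.isSymm_adjMatrix))).sort (· ≤ ·)).reverse

/-- `adjEig G i` is the `i`-th largest adjacency eigenvalue of `G` (`1`-indexed),
so `adjEig G 1 = λ₁(G) ≥ adjEig G 2 = λ₂(G) ≥ ⋯`. -/
noncomputable def adjEig {V : Type} [Fintype V] [DecidableEq V] (G : SimpleGraph V) (i : ℕ) :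
    ℝ :=
  (adjEigs G).getD (i - 1) 0

/-- The number of connected components of `G − S`, the subgraph of `G` induced on the
complement of `S`. -/
noncomputable def numComp {V : Type} (G : SimpleGraph V) (S : Set V) : ℕ :=
  Nat.card (G.induce Sᶜ).ConnectedComponent

/-- `S` is an independent set of `G`. -/
def IsIndep {V : Type} (G : SimpleGraph V) (S : Set V) : Prop :=
  S.Pairwise fun u v => ¬ G.Adj u v

theorem adjEigs_eq_ofFn_eigenvalues₀ {V : Type} [Fintype V] [DecidableEq V]
    (G : SimpleGraph V) [inst : DecidableRel G.Adj] (hA : (G.adjMatrix ℝ).IsHermitian) :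
    adjEigs G = List.ofFn hA.eigenvalues₀ := by
  have key : ((Finset.univ.val.map hA.eigenvalues).sort (· ≤ ·)).reverse =
      List.ofFn hA.eigenvalues₀ := by
    refine List.Perm.eq_of_sortedGE ?_ hA.eigenvalues₀_antitone.sortedGE_ofFn ?_
    · exact (Multiset.pairwise_sort _ (· ≤ ·)).sortedLE.reverse
    · rw [← Multiset.coe_eq_coe, Multiset.coe_reverse, Multiset.sort_eq, ← Fin.univ_val_map]
      have hcomp : hA.eigenvalues = hA.eigenvalues₀ ∘
          (Fintype.equivOfCardEq (Fintype.card_fin (Fintype.card V))).symm := rfl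
      rw [hcomp, ← Multiset.map_map, Multiset.map_univ_val_equiv]
  obtain rfl : inst = fun a b => Classical.propDecidable (G.Adj a b) := Subsingleton.elim _ _
  exact key

theorem adjEig_card_le_eigenvalues {V : Type} [Fintype V] [DecidableEq V]
    (G : SimpleGraph V) [DecidableRel G.Adj] (hA : (G.adjMatrix ℝ).IsHermitian) (v : V) :
    adjEig G (Fintype.card V) ≤ hA.eigenvalues v := by
  have hpos : 0 < Fintype.card V := Fintype.card_pos_iff.mpr ⟨v⟩
  have hlt : Fintype.card V - 1 < (List.ofFn hA.eigenvalues₀).length := by simp; omega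
  rw [adjEig, adjEigs_eq_ofFn_eigenvalues₀ G hA, List.getD_eq_getElem _ _ hlt, List.getElem_ofFn]
  exact hA.eigenvalues₀_antitone (Fin.mk_le_mk.mpr (by omega))

theorem eigenvalues_le_adjEig_two_or {V : Type} [Fintype V] [DecidableEq V]
    (G : SimpleGraph V) [DecidableRel G.Adj] (hA : (G.adjMatrix ℝ).IsHermitian) {v w : V}
    (hvw : v ≠ w) :
    hA.eigenvalues v ≤ adjEig G 2 ∨ hA.eigenvalues w ≤ adjEig G 2 := by
  have hcard : 1 < Fintype.card V := Fintype.one_lt_card_iff.mpr ⟨v, w, hvw⟩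
  have hlt : 2 - 1 < (List.ofFn hA.eigenvalues₀).length := by simpa using hcard
  rw [adjEig, adjEigs_eq_ofFn_eigenvalues₀ G hA, List.getD_eq_getElem _ _ hlt, List.getElem_ofFn]
  let σ := (Fintype.equivOfCardEq (Fintype.card_fin (Fintype.card V)) : Fin _ ≃ V).symm
  have hσ : (σ v : ℕ) ≠ σ w := fun h => hvw (σ.injective (Fin.ext h))
  rcases Nat.eq_zero_or_pos (σ v : ℕ) with h | h
  · exact .inr (hA.eigenvalues₀_antitone (Fin.mk_le_mk.mpr (by change 1 ≤ (σ w : ℕ); omega)))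
  · exact .inl (hA.eigenvalues₀_antitone (Fin.mk_le_mk.mpr h))

/-- If all but the top eigenvalue `d` of a real symmetric matrix are bounded by `l < d` in absolute
value, the bilinear form it defines is bounded by `l` on the orthogonal complement of
an eigenvector `e` for `d`. -/
theorem sq_dotProduct_mulVec_le {V : Type} [Fintype V] [DecidableEq V] {A : Matrix V V ℝ}
    (hA : A.IsHermitian) {d l : ℝ} (hl : l < d)
    (hupper : ∀ v w, v ≠ w → hA.eigenvalues v ≤ l ∨ hA.eigenvalues w ≤ l)
    (hlower : ∀ v, -l ≤ hA.eigenvalues v) {e : V → ℝ} (he : A *ᵥ e = d • e) (he0 : e ≠ 0)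
    {f : V → ℝ} (hf : e ⬝ᵥ f = 0) (g : V → ℝ) :
    (f ⬝ᵥ A *ᵥ g) ^ 2 ≤ l ^ 2 * (f ⬝ᵥ f) * (g ⬝ᵥ g) := by
  let u : V → V → ℝ := fun i => (hA.eigenvectorBasis i).ofLp
  have parseval : ∀ x y : V → ℝ, x ⬝ᵥ y = ∑ i, (u i ⬝ᵥ x) * (u i ⬝ᵥ y) := by
    intro x y
    have h := hA.eigenvectorBasis.sum_inner_mul_inner (WithLp.toLp 2 x) (WithLp.toLp 2 y)
    simp only [EuclideanSpace.inner_eq_star_dotProduct, star_trivial] at h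
    rw [dotProduct_comm, ← h]
    exact Finset.sum_congr rfl fun i _ => by rw [dotProduct_comm y]
  have hu : ∀ i (x : V → ℝ), u i ⬝ᵥ A *ᵥ x = hA.eigenvalues i * (u i ⬝ᵥ x) := by
    intro i x
    have hT : Aᵀ = A := by simpa [conjTranspose_eq_transpose_of_trivial] using hA.eq
    rw [dotProduct_mulVec, ← mulVec_transpose, hT, hA.mulVec_eigenvectorBasis, smul_dotProduct,
      smul_eq_mul]
  have hcoef : ∀ i, u i ⬝ᵥ e ≠ 0 → hA.eigenvalues i = d := by
    intro i hi
    have h := hu i e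
    rw [he, dotProduct_smul, smul_eq_mul] at h
    exact (mul_right_cancel₀ hi h).symm
  obtain ⟨i₀, hi₀⟩ : ∃ i, u i ⬝ᵥ e ≠ 0 := by
    by_contra! h
    exact he0 (dotProduct_self_eq_zero.mp (by rw [parseval]; simp [h]))
  have hle : ∀ i, i ≠ i₀ → hA.eigenvalues i ≤ l := fun i hi =>
    (hupper i i₀ hi).resolve_right (by rw [hcoef i₀ hi₀]; exact not_le.mpr hl)
  have hf0 : u i₀ ⬝ᵥ f = 0 := by
    rw [parseval, Finset.sum_eq_single i₀ _ (by simp)] at hf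
    · exact (mul_eq_zero.mp hf).resolve_left hi₀
    · intro i _ hi
      have : u i ⬝ᵥ e = 0 := by
        by_contra h
        exact absurd (hle i hi) (by rw [hcoef i h]; exact not_le.mpr hl)
      rw [this, zero_mul]
  have hexp : f ⬝ᵥ A *ᵥ g = ∑ i, (hA.eigenvalues i * (u i ⬝ᵥ f)) * (u i ⬝ᵥ g) := by
    rw [parseval]
    exact Finset.sum_congr rfl fun i _ => by rw [hu]; ring
  rw [hexp]
  refine (Finset.sum_mul_sq_le_sq_mul_sq _ _ _).trans ?_
  rw [parseval f f, parseval g g, Finset.mul_sum _ _ (l ^ 2)]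
  simp only [← pow_two]
  refine mul_le_mul_of_nonneg_right (Finset.sum_le_sum fun i _ => ?_)
    (Finset.sum_nonneg fun i _ => sq_nonneg (u i ⬝ᵥ g))
  rw [mul_pow]
  rcases eq_or_ne i i₀ with rfl | hi
  · simp [hf0]
  · exact mul_le_mul_of_nonneg_right (sq_le_sq' (hlower i) (hle i hi)) (sq_nonneg _)

/-- Expander mixing for two sets of vertices (possibly equal) with no edge between them. -/
theorem card_mul_card_le_of_forall_not_adj {V : Type} [Fintype V] [DecidableEq V]
    (G : SimpleGraph V) [DecidableRel G.Adj] {k : ℕ} (hreg : G.IsRegularOfDegree k)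
    {l : ℝ} (hl : l = max |adjEig G 2| |adjEig G (Fintype.card V)|) (hlk : l < k)
    (X Y : Finset V) (hXY : ∀ x ∈ X, ∀ y ∈ Y, ¬ G.Adj x y) :
    (k : ℝ) ^ 2 * (X.card * Y.card) ≤
      l ^ 2 * ((Fintype.card V - X.card) * (Fintype.card V - Y.card)) := by
  have hX : (X.card : ℝ) ≤ Fintype.card V := by exact_mod_cast X.card_le_univ
  have hY : (Y.card : ℝ) ≤ Fintype.card V := by exact_mod_cast Y.card_le_univ
  rcases X.eq_empty_or_nonempty with rfl | hXne
  · have h := mul_nonneg (Nat.cast_nonneg (α := ℝ) (Fintype.card V)) (sub_nonneg.mpr hY)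
    simpa using mul_nonneg (sq_nonneg l) h
  rcases Y.eq_empty_or_nonempty with rfl | hYne
  · have h := mul_nonneg (sub_nonneg.mpr hX) (Nat.cast_nonneg (α := ℝ) (Fintype.card V))
    simpa using mul_nonneg (sq_nonneg l) h
  have hX0 : (0 : ℝ) < X.card := by exact_mod_cast hXne.card_pos
  have hY0 : (0 : ℝ) < Y.card := by exact_mod_cast hYne.card_pos
  have hn0 : (0 : ℝ) < Fintype.card V := hX0.trans_le hX
  have hA : (G.adjMatrix ℝ).IsHermitian := by
    rw [Matrix.IsHermitian, Matrix.conjTranspose_eq_transpose_of_trivial]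
    exact G.isSymm_adjMatrix
  have hupper : ∀ v w, v ≠ w → hA.eigenvalues v ≤ l ∨ hA.eigenvalues w ≤ l := by
    have h2 : adjEig G 2 ≤ l := hl ▸ (le_abs_self _).trans (le_max_left _ _)
    exact fun v w hvw => (eigenvalues_le_adjEig_two_or G hA hvw).imp
      (fun h => h.trans h2) (fun h => h.trans h2)
  have hlower : ∀ v, -l ≤ hA.eigenvalues v := by
    have hn : -l ≤ adjEig G (Fintype.card V) :=
      neg_le.mp ((neg_le_abs (adjEig G (Fintype.card V))).trans (hl ▸ le_max_right _ _))
    exact fun v => hn.trans (adjEig_card_le_eigenvalues G hA v)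
  let e : V → ℝ := fun _ => 1
  have he : G.adjMatrix ℝ *ᵥ e = (k : ℝ) • e := by
    ext v
    simp [e, adjMatrix_mulVec_apply, hreg.degree_eq v]
  have he0 : e ≠ 0 := fun h => by
    obtain ⟨v, -⟩ := hXne
    simpa [e] using congrFun h v
  let ind : Finset V → V → ℝ := fun Z v => if v ∈ Z then 1 else 0
  have hee : e ⬝ᵥ e = Fintype.card V := by simp [e, dotProduct]
  have hei : ∀ Z, e ⬝ᵥ ind Z = Z.card := fun Z => by simp [e, ind, dotProduct]
  have hii : ∀ Z, ind Z ⬝ᵥ ind Z = Z.card := fun Z => by simp [ind, dotProduct]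
  have heA : ∀ x, e ⬝ᵥ G.adjMatrix ℝ *ᵥ x = k * (e ⬝ᵥ x) := fun x => by
    rw [dotProduct_mulVec, ← mulVec_transpose, transpose_adjMatrix, he, smul_dotProduct,
      smul_eq_mul]
  have hiAi : ind X ⬝ᵥ G.adjMatrix ℝ *ᵥ ind Y = 0 := by
    refine Finset.sum_eq_zero fun v _ => ?_
    by_cases hv : v ∈ X
    · rw [adjMatrix_mulVec_apply, Finset.sum_eq_zero, mul_zero]
      intro w hw
      have : w ∉ Y := fun hwY => hXY v hv w hwY ((G.mem_neighborFinset v w).mp hw)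
      simp [ind, this]
    · simp [ind, hv]
  let c : Finset V → V → ℝ := fun Z => ind Z - (Z.card / Fintype.card V : ℝ) • e
  have hec : ∀ Z, e ⬝ᵥ c Z = 0 := fun Z => by
    simp only [c, dotProduct_sub, dotProduct_smul, hei, hee, smul_eq_mul]
    field_simp
    ring
  have hcc : ∀ Z : Finset V,
      c Z ⬝ᵥ c Z = Z.card * (Fintype.card V - Z.card) / Fintype.card V := fun Z => by
    have : c Z ⬝ᵥ c Z = ind Z ⬝ᵥ c Z - (Z.card / Fintype.card V : ℝ) * (e ⬝ᵥ c Z) := by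
      conv_lhs => enter [1]; simp only [c]
      rw [sub_dotProduct, smul_dotProduct, smul_eq_mul]
    rw [this, hec]
    simp only [c, dotProduct_sub, dotProduct_smul, hii, smul_eq_mul, dotProduct_comm _ e, hei]
    field_simp
    ring
  have hcAc : c X ⬝ᵥ G.adjMatrix ℝ *ᵥ c Y = -(k * X.card * Y.card / Fintype.card V) := by
    have : G.adjMatrix ℝ *ᵥ c Y =
        G.adjMatrix ℝ *ᵥ ind Y - (Y.card / Fintype.card V * k : ℝ) • e := by
      simp only [c, mulVec_sub, mulVec_smul, he, smul_smul]
    rw [this, dotProduct_sub, dotProduct_smul, dotProduct_comm (c X) e, hec]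
    simp only [c, sub_dotProduct, smul_dotProduct, hiAi, heA, hei, smul_eq_mul]
    ring
  have h := sq_dotProduct_mulVec_le hA hlk hupper hlower he he0 (hec X) (c Y)
  rw [hcAc, hcc, hcc] at h
  have hpos : (0 : ℝ) < X.card * Y.card / (Fintype.card V) ^ 2 := by positivity
  refine le_of_mul_le_mul_left ?_ hpos
  calc _ = (-(k * X.card * Y.card / Fintype.card V : ℝ)) ^ 2 := by ring
    _ ≤ _ := h
    _ = _ := by ring

/-- The vertices of `G - S` lying in one of the components in `T`. -/
noncomputable def compVerts {V : Type} [Fintype V] (G : SimpleGraph V) (S : Set V)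
    (T : Finset (G.induce Sᶜ).ConnectedComponent) : Finset V := by
  classical
  exact Finset.univ.filter fun v =>
    ∃ h : v ∈ Sᶜ, (G.induce Sᶜ).connectedComponentMk ⟨v, h⟩ ∈ T

theorem mem_compVerts {V : Type} [Fintype V] {G : SimpleGraph V} {S : Set V}
    {T : Finset (G.induce Sᶜ).ConnectedComponent} {v : V} :
    v ∈ compVerts G S T ↔ ∃ h : v ∈ Sᶜ, (G.induce Sᶜ).connectedComponentMk ⟨v, h⟩ ∈ T := by
  simp [compVerts]

theorem out_val_injective {V : Type} {G : SimpleGraph V} {S : Set V} :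
    Function.Injective fun C : (G.induce Sᶜ).ConnectedComponent => (Quot.out C).val := by
  intro C D h
  rw [← Quot.out_eq C, ← Quot.out_eq D, Subtype.ext h]

theorem card_le_card_compVerts {V : Type} [Fintype V] (G : SimpleGraph V) (S : Set V)
    (T : Finset (G.induce Sᶜ).ConnectedComponent) : T.card ≤ (compVerts G S T).card := by
  refine Finset.card_le_card_of_injOn (fun C => (Quot.out C).val) (fun C hC => ?_)
    out_val_injective.injOn
  refine mem_compVerts.mpr ⟨(Quot.out C).property, ?_⟩
  have h : (G.induce Sᶜ).connectedComponentMk (Quot.out C) = C := Quot.out_eq C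
  rw [Subtype.coe_eta, h]
  exact hC

theorem not_adj_of_mem_compVerts {V : Type} [Fintype V] {G : SimpleGraph V} {S : Set V}
    {T U : Finset (G.induce Sᶜ).ConnectedComponent} (hTU : Disjoint T U) {v w : V}
    (hv : v ∈ compVerts G S T) (hw : w ∈ compVerts G S U) : ¬ G.Adj v w := by
  intro hadj
  obtain ⟨hvS, hvT⟩ := mem_compVerts.mp hv
  obtain ⟨hwS, hwU⟩ := mem_compVerts.mp hw
  have hadj' : (G.induce Sᶜ).Adj ⟨v, hvS⟩ ⟨w, hwS⟩ := hadj
  rw [SimpleGraph.ConnectedComponent.sound hadj'.reachable] at hvT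
  exact Finset.disjoint_left.mp hTU hvT hwU

theorem exists_indep_card_eq_numComp {V : Type} [Fintype V] (G : SimpleGraph V)
    (S : Set V) :
    ∃ I : Finset V, I.card = numComp G S ∧ ∀ v ∈ I, ∀ w ∈ I, ¬ G.Adj v w := by
  classical
  refine ⟨Finset.univ.image fun C : (G.induce Sᶜ).ConnectedComponent => (Quot.out C).val, ?_, ?_⟩
  · rw [Finset.card_image_of_injective _ out_val_injective, Finset.card_univ, numComp,
      Nat.card_eq_fintype_card]
  · simp only [Finset.mem_image, Finset.mem_univ, true_and]
    rintro _ ⟨C, rfl⟩ _ ⟨D, rfl⟩ hadj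
    have hadj' : (G.induce Sᶜ).Adj (Quot.out C) (Quot.out D) := hadj
    have h : C = D := by
      rw [← Quot.out_eq C, ← Quot.out_eq D]
      exact SimpleGraph.ConnectedComponent.sound hadj'.reachable
    exact G.irrefl (h ▸ hadj)

/-- The vertices outside a set `S` leaving at least two components split into two parts with no
edge between them, each having at least a third as many vertices as there are components. -/
theorem exists_separated_partition {V : Type} [Fintype V] (G : SimpleGraph V) {S : Set V}
    (hS : 2 ≤ numComp G S) :
    ∃ X Y : Finset V, X.card + Y.card + S.ncard = Fintype.card V ∧
      numComp G S ≤ 3 * X.card ∧ numComp G S ≤ 3 * Y.card ∧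
      ∀ x ∈ X, ∀ y ∈ Y, ¬ G.Adj x y := by
  classical
  have hcard : Fintype.card (G.induce Sᶜ).ConnectedComponent = numComp G S := by
    rw [numComp, Nat.card_eq_fintype_card]
  obtain ⟨T, -, hT⟩ := Finset.exists_subset_card_eq
    (s := (Finset.univ : Finset (G.induce Sᶜ).ConnectedComponent)) (n := numComp G S / 2)
    (by rw [Finset.card_univ, hcard]; omega)
  have hTc : Tᶜ.card = numComp G S - numComp G S / 2 := by rw [Finset.card_compl, hcard, hT]
  refine ⟨compVerts G S T, compVerts G S Tᶜ, ?_, ?_, ?_, fun x hx y hy =>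
    not_adj_of_mem_compVerts disjoint_compl_right hx hy⟩
  · have hdisj : Disjoint (compVerts G S T) (compVerts G S Tᶜ) := by
      refine Finset.disjoint_left.mpr fun v hv hv' => ?_
      obtain ⟨h, hT⟩ := mem_compVerts.mp hv
      obtain ⟨_, hT'⟩ := mem_compVerts.mp hv'
      exact Finset.mem_compl.mp hT' hT
    have hunion : compVerts G S T ∪ compVerts G S Tᶜ = S.toFinsetᶜ := by
      ext v
      simp only [Finset.mem_union, mem_compVerts, Finset.mem_compl, Set.mem_toFinset,
        ← exists_or, em, exists_prop, and_true, Set.mem_compl_iff]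
    rw [← Finset.card_union_of_disjoint hdisj, hunion, Set.ncard_eq_toFinset_card',
      Finset.card_compl_add_card]
  · have := card_le_card_compVerts G S T
    omega
  · have := card_le_card_compVerts G S Tᶜ
    omega

theorem toughness_inequalities_contradiction {k l n s c x y : ℝ} (hl : 0 < l) (hlk : l < k)
    (hs : 0 ≤ s) (hc : 0 < c) (hsum : x + y + s = n) (hx : c ≤ 3 * x) (hy : c ≤ 3 * y)
    (hmix : k ^ 2 * (x * y) ≤ l ^ 2 * ((n - x) * (n - y)))
    (hind : k * c ≤ l * (n - c))
    (hsmall : 3 * s * (l * (k + l)) ≤ c * (k ^ 2 - (k * l + l ^ 2))) : False := by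
  have hk : 0 < k := hl.trans hlk
  have hn : 0 < n := by linarith
  have hq : 0 ≤ k ^ 2 - (k * l + l ^ 2) :=
    nonneg_of_mul_nonneg_right ((by positivity : 0 ≤ 3 * s * (l * (k + l))).trans hsmall) hc
  have hsn : 3 * s < n := by
    have h1 : 3 * s * (l * (k + l) ^ 2) ≤ l * n * (k ^ 2 - (k * l + l ^ 2)) := by
      have h2 : c * (k + l) ≤ l * n := by linarith
      have h3 := mul_le_mul_of_nonneg_right h2 hq
      have h4 := mul_le_mul_of_nonneg_right hsmall (by positivity : 0 ≤ k + l)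
      linarith
    have h5 : l * n * (k ^ 2 - (k * l + l ^ 2)) < n * (l * (k + l) ^ 2) := by
      have : 0 < l * n * (3 * k * l + 2 * l ^ 2) := by positivity
      linarith
    exact lt_of_mul_lt_mul_right (h1.trans_lt h5) (by positivity)
  have hxy : n * c ≤ 9 * (x * y) := by
    rcases le_total x y with h | h
    · have := mul_le_mul (by linarith : n ≤ 3 * y) hx hc.le (by linarith)
      linarith
    · have := mul_le_mul (by linarith : n ≤ 3 * x) hy hc.le (by linarith)
      linarith
  have hkl : 0 < k ^ 2 - l ^ 2 := by nlinarith
  have h1 : (k ^ 2 - l ^ 2) * (x * y) ≤ l ^ 2 * (n * s) := by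
    have : (n - x) * (n - y) = n * s + x * y := by rw [← hsum]; ring
    rw [this] at hmix
    linarith
  have h2 : (k ^ 2 - l ^ 2) * c ≤ 9 * l ^ 2 * s := by
    have h3 := mul_le_mul_of_nonneg_left hxy hkl.le
    refine le_of_mul_le_mul_left ?_ hn
    linarith
  have h3 : (k ^ 2 - l ^ 2) * (k + l) ≤ 3 * l * (k ^ 2 - (k * l + l ^ 2)) := by
    have h4 := mul_le_mul_of_nonneg_right h2 (by positivity : 0 ≤ k + l)
    have h5 := mul_le_mul_of_nonneg_left hsmall (by positivity : 0 ≤ 3 * l)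
    refine le_of_mul_le_mul_left ?_ hc
    linarith
  have h4 : 0 ≤ k * (k - l) ^ 2 := by positivity
  have h5 : 0 < k * l ^ 2 + 2 * l ^ 3 := by positivity
  linarith

/-- **Alon's toughness bound.** If `G` is a connected noncomplete `k`-regular graph
(`k ≥ 1`) on `n` vertices and `λ = max (|λ₂|, |λₙ|)`, then every disconnecting set `S`
satisfies `|S|/c(G − S) > (1/3)(k²/(kλ + λ²) − 1)`; in particular
`t(G) > (1/3)(k²/(kλ + λ²) − 1)`. -/
theorem alon_toughness_bound {V : Type} [Fintype V] [DecidableEq V]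
    (G : SimpleGraph V) [DecidableRel G.Adj] (k : ℕ) (hk : 1 ≤ k)
    (hreg : G.IsRegularOfDegree k) (hconn : G.Connected) (hnc : G ≠ ⊤)
    (lam : ℝ) (hlam : lam = max |adjEig G 2| |adjEig G (Fintype.card V)|) :
    ∀ S : Set V, 2 ≤ numComp G S →
      (1 / 3 : ℝ) * ((k : ℝ) ^ 2 / ((k : ℝ) * lam + lam ^ 2) - 1)
        < (S.ncard : ℝ) / (numComp G S : ℝ) := by
  intro S hS
  have hk0 : (0 : ℝ) < k := by exact_mod_cast hk
  have hc : (0 : ℝ) < numComp G S := by exact_mod_cast (by omega : 0 < numComp G S)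
  have hratio : (0 : ℝ) ≤ S.ncard / numComp G S := by positivity
  have hlam0 : 0 ≤ lam := hlam ▸ (abs_nonneg _).trans (le_max_left _ _)
  rcases hlam0.eq_or_lt with h0 | hpos
  · rw [← h0]
    norm_num
    linarith
  have hden : 0 < (k : ℝ) * lam + lam ^ 2 := by positivity
  by_contra! hcon
  rcases le_or_gt (k : ℝ) lam with hle | hlt
  · have : (k : ℝ) ^ 2 / (k * lam + lam ^ 2) < 1 := by
      rw [div_lt_one hden]
      nlinarith
    linarith
  obtain ⟨I, hIcard, hI⟩ := exists_indep_card_eq_numComp G S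
  obtain ⟨X, Y, hsum, hX, hY, hXY⟩ := exists_separated_partition G hS
  have hind := card_mul_card_le_of_forall_not_adj G hreg hlam hlt I I hI
  have hmix := card_mul_card_le_of_forall_not_adj G hreg hlam hlt X Y hXY
  have hIle : (numComp G S : ℝ) ≤ Fintype.card V := by
    rw [← hIcard]
    exact_mod_cast I.card_le_univ
  rw [hIcard] at hind
  refine toughness_inequalities_contradiction hpos hlt (Nat.cast_nonneg S.ncard) hc
    (by exact_mod_cast hsum) (by exact_mod_cast hX) (by exact_mod_cast hY) hmix ?_ ?_
  · refine abs_le_of_sq_le_sq' ?_ (mul_nonneg hlam0 (sub_nonneg.mpr hIle)) |>.2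
    linarith
  · rw [div_le_iff₀ hc, div_sub_one hden.ne', mul_div_assoc', div_mul_eq_mul_div,
      le_div_iff₀ hden] at hcon
    linarith
end

section
/- Let k ≥ 1 and let G be a connected noncomplete k-regular finite simple graph on n vertices, and let λ = max(|λ_2(G)|, |λ_n(G)|). Then every disconnecting set S of G satisfies |S|/c(G − S) > k/λ − 2; in particular t(G) > k/λ − 2. -/
open SimpleGraph Matrix

theorem exists_forall_ne_abs_le_sorted {V : Type} [Fintype V] [DecidableEq V] [Nonempty V]
    (f : V → ℝ) (L : List ℝ) (hL : (L : Multiset ℝ) = Finset.univ.val.map f)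
    (hs : L.Pairwise (· ≥ ·)) :
    ∃ i₀, ∀ i ≠ i₀, |f i| ≤ max |L.getD 1 0| |L.getD (Fintype.card V - 1) 0| := by
  have hlen : L.length = Fintype.card V := by
    have := congrArg Multiset.card hL
    simpa using this
  rcases L with _ | ⟨x, L⟩
  · simp at hlen
    exact absurd hlen.symm Fintype.card_ne_zero
  have hx : x ∈ Finset.univ.val.map f := by rw [← hL]; simp
  obtain ⟨i₀, -, hi₀⟩ := Multiset.mem_map.1 hx
  refine ⟨i₀, fun i hi => ?_⟩
  have hL' : (L : Multiset ℝ) = (Finset.univ.erase i₀).val.map f := by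
    have h1 : (Finset.univ : Finset V).val = i₀ ::ₘ (Finset.univ.erase i₀).val := by
      rw [Finset.erase_val, Multiset.cons_erase (Finset.mem_univ i₀)]
    rw [h1, Multiset.map_cons, hi₀, ← Multiset.cons_coe] at hL
    exact (Multiset.cons_inj_right x).1 hL
  have hmem : f i ∈ L := by
    rw [← Multiset.mem_coe, hL']
    exact Multiset.mem_map_of_mem f (Finset.mem_erase.2 ⟨hi, Finset.mem_univ i⟩)
  obtain ⟨j, hj, hji⟩ := List.getElem_of_mem hmem
  have hs' := (List.pairwise_cons.1 hs).2
  have hle : ∀ (a b : ℕ) (hb : b < L.length) (hab : a ≤ b), L[b] ≤ L[a] := by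
    intro a b hb hab
    rcases hab.eq_or_lt with rfl | h
    · rfl
    · exact List.pairwise_iff_getElem.1 hs' a b (h.trans hb) hb h
  simp only [List.length_cons] at hlen
  have e1 : (x :: L).getD 1 0 = L[0] := by
    simp [List.getD_eq_getElem?_getD, List.getElem?_eq_getElem (show 0 < L.length by omega)]
  have e2 : (x :: L).getD (Fintype.card V - 1) 0 = L[L.length - 1] := by
    rw [← hlen, List.getD_eq_getElem _ _ (by simp)]
    simp only [Nat.add_sub_cancel]
    rw [List.getElem_cons, dif_neg (by omega)]
  rw [e1, e2, ← hji]
  exact (abs_le_max_abs_abs (hle j _ (by omega) (by omega)) (hle 0 j hj (by omega))).trans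
    (max_comm _ _).le

/-- If all eigenvalues but one are at most `lam` in absolute value and `1` is an eigenvector for a
larger eigenvalue, then `A` expands vectors orthogonal to `1` by a factor of at most `lam`. -/
theorem mulVec_dotProduct_self_le_of_orthogonal {V : Type} [Fintype V] [DecidableEq V]
    [Nonempty V] {A : Matrix V V ℝ} (hA : A.IsHermitian) {k lam : ℝ} (hlt : lam < k)
    (hA1 : A *ᵥ 1 = k • 1) {i₀ : V} (hi₀ : ∀ i ≠ i₀, |hA.eigenvalues i| ≤ lam)
    {f : V → ℝ} (hf : f ⬝ᵥ 1 = 0) :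
    (A *ᵥ f) ⬝ᵥ (A *ᵥ f) ≤ lam ^ 2 * (f ⬝ᵥ f) := by
  set b : V → V → ℝ := fun i => (hA.eigenvectorBasis i).ofLp
  have parseval (x y : V → ℝ) : ∑ i, (b i ⬝ᵥ x) * (b i ⬝ᵥ y) = x ⬝ᵥ y := by
    have := hA.eigenvectorBasis.sum_inner_mul_inner (WithLp.toLp 2 x) (WithLp.toLp 2 y)
    simp only [EuclideanSpace.inner_eq_star_dotProduct, star_trivial] at this
    rw [dotProduct_comm x y, ← this]
    exact Finset.sum_congr rfl fun i _ => by rw [dotProduct_comm (b i) y]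
  have coeff (i : V) (x : V → ℝ) : b i ⬝ᵥ (A *ᵥ x) = hA.eigenvalues i * (b i ⬝ᵥ x) := by
    have hT : Aᵀ = A := by simpa [conjTranspose_eq_transpose_of_trivial] using hA.eq
    rw [dotProduct_mulVec, ← mulVec_transpose, hT, hA.mulVec_eigenvectorBasis i, smul_dotProduct,
      smul_eq_mul]
  have hone (i : V) (hi : i ≠ i₀) : b i ⬝ᵥ 1 = 0 := by
    have h := coeff i 1
    rw [hA1, dotProduct_smul, smul_eq_mul] at h
    have hne : k - hA.eigenvalues i ≠ 0 := by
      have := (abs_le.1 (hi₀ i hi)).2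
      linarith
    exact (mul_eq_zero.1 (show (k - hA.eigenvalues i) * (b i ⬝ᵥ 1) = 0 by linarith)).resolve_left
      hne
  have hsingle (x : V → ℝ) : (b i₀ ⬝ᵥ x) * (b i₀ ⬝ᵥ 1) = x ⬝ᵥ 1 := by
    rw [← parseval x 1, Finset.sum_eq_single i₀ (fun i _ hi => by rw [hone i hi, mul_zero])
      (fun h => absurd (Finset.mem_univ i₀) h)]
  have hf0 : b i₀ ⬝ᵥ f = 0 := by
    refine (mul_eq_zero.1 ((hsingle f).trans hf)).resolve_right fun h => ?_
    have h1 := hsingle 1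
    rw [h, mul_zero] at h1
    simp [eq_comm] at h1
  rw [← parseval, ← parseval f f, Finset.mul_sum]
  refine Finset.sum_le_sum fun i _ => ?_
  rw [coeff]
  by_cases hi : i = i₀
  · simp [hi, hf0]
  · have := sq_le_sq' (abs_le.1 (hi₀ i hi)).1 (abs_le.1 (hi₀ i hi)).2
    nlinarith [mul_le_mul_of_nonneg_right this (mul_self_nonneg (b i ⬝ᵥ f))]

theorem adjMatrix_mulVec_one {V : Type} [Fintype V] {G : SimpleGraph V} [DecidableRel G.Adj]
    {k : ℕ} (hreg : G.IsRegularOfDegree k) : G.adjMatrix ℝ *ᵥ 1 = (k : ℝ) • 1 := by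
  ext v
  simpa using adjMatrix_mulVec_const_apply_of_regular (α := ℝ) (a := 1) hreg (v := v)

/-- Two vertex sets without edges between them are small: the expander mixing bound. -/
theorem card_mul_card_le_of_no_edges {V : Type} [Fintype V] [DecidableEq V]
    {G : SimpleGraph V} [DecidableRel G.Adj] {k : ℕ} (hreg : G.IsRegularOfDegree k) {lam : ℝ}
    (hlam : ∀ f : V → ℝ, f ⬝ᵥ 1 = 0 →
      (G.adjMatrix ℝ *ᵥ f) ⬝ᵥ (G.adjMatrix ℝ *ᵥ f) ≤ lam ^ 2 * (f ⬝ᵥ f))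
    {B C : Finset V} (hB : B.Nonempty) (hC : C.Nonempty)
    (hBC : ∀ u ∈ B, ∀ v ∈ C, ¬ G.Adj u v) :
    (k : ℝ) ^ 2 * (B.card * C.card) ≤
      lam ^ 2 * ((Fintype.card V - B.card) * (Fintype.card V - C.card)) := by
  have hV : (0 : ℝ) < Fintype.card V := by
    obtain ⟨v, -⟩ := hB
    exact_mod_cast Fintype.card_pos_iff.2 ⟨v⟩
  set n : ℝ := ((Fintype.card V : ℕ) : ℝ) with hn
  set A := G.adjMatrix ℝ with hA
  let ind : Finset V → V → ℝ := fun X v => if v ∈ X then 1 else 0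
  let cen : Finset V → V → ℝ := fun X => n • ind X - (X.card : ℝ) • 1
  have ind_one (X : Finset V) : ind X ⬝ᵥ 1 = X.card := by simp [ind, dotProduct]
  have ind_ind (X : Finset V) : ind X ⬝ᵥ ind X = X.card := by simp [ind, dotProduct]
  have one_one : (1 : V → ℝ) ⬝ᵥ 1 = n := by simp [hn]
  have cen_one (X : Finset V) : cen X ⬝ᵥ 1 = 0 := by
    simp only [cen, sub_dotProduct, smul_dotProduct, ind_one, one_one, smul_eq_mul]
    ring
  have cen_cen (X : Finset V) : cen X ⬝ᵥ cen X = n * (X.card * (n - X.card)) := by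
    have : cen X ⬝ᵥ cen X = n * (cen X ⬝ᵥ ind X) - X.card * (cen X ⬝ᵥ 1) := by
      conv_lhs => rw [show cen X = n • ind X - (X.card : ℝ) • 1 from rfl]
      simp only [cen, dotProduct_sub, dotProduct_smul, smul_eq_mul]
    rw [this, cen_one]
    simp only [cen, sub_dotProduct, smul_dotProduct, ind_ind, dotProduct_comm 1 (ind X), ind_one,
      smul_eq_mul]
    ring
  have hA1 : A *ᵥ 1 = (k : ℝ) • 1 := adjMatrix_mulVec_one hreg
  have hAC : ind B ⬝ᵥ (A *ᵥ ind C) = 0 := by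
    simp only [dotProduct, mulVec, ind, hA, adjMatrix_apply]
    refine Finset.sum_eq_zero fun u _ => ?_
    by_cases hu : u ∈ B
    · rw [if_pos hu, one_mul]
      refine Finset.sum_eq_zero fun v _ => ?_
      by_cases hv : v ∈ C
      · simp [hBC u hu v hv]
      · simp [hv]
    · simp [hu]
  have h1A : (1 : V → ℝ) ⬝ᵥ (A *ᵥ ind C) = k * C.card := by
    rw [dotProduct_mulVec, ← mulVec_transpose, hA, transpose_adjMatrix, ← hA, hA1,
      smul_dotProduct, dotProduct_comm, ind_one, smul_eq_mul]
  have hform : cen B ⬝ᵥ (A *ᵥ cen C) = -(n * (k * (B.card * C.card))) := by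
    have : A *ᵥ cen C = n • (A *ᵥ ind C) - ((C.card : ℝ) * k) • 1 := by
      simp only [cen, mulVec_sub, mulVec_smul, hA1, smul_smul]
    rw [this, dotProduct_sub, dotProduct_smul, dotProduct_smul, cen_one]
    simp only [cen, sub_dotProduct, smul_dotProduct, hAC, h1A, smul_eq_mul]
    ring
  have hcs : (cen B ⬝ᵥ (A *ᵥ cen C)) ^ 2 ≤
      (cen B ⬝ᵥ cen B) * ((A *ᵥ cen C) ⬝ᵥ (A *ᵥ cen C)) := by
    have := Finset.sum_mul_sq_le_sq_mul_sq Finset.univ (cen B) (A *ᵥ cen C)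
    simpa only [dotProduct, sq] using this
  have hnn : 0 ≤ cen B ⬝ᵥ cen B := by
    simpa only [dotProduct] using Finset.sum_nonneg fun v _ => mul_self_nonneg (cen B v)
  have hfin := hcs.trans (mul_le_mul_of_nonneg_left (hlam _ (cen_one C)) hnn)
  rw [hform, cen_cen, cen_cen] at hfin
  have hb : (0 : ℝ) < B.card := by exact_mod_cast hB.card_pos
  have hc : (0 : ℝ) < C.card := by exact_mod_cast hC.card_pos
  have hpos : 0 < n ^ 2 * (B.card * C.card : ℝ) := by positivity
  refine le_of_mul_le_mul_left ?_ hpos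
  calc _ = (-(n * (k * (B.card * C.card)))) ^ 2 := by ring
    _ ≤ _ := hfin
    _ = _ := by ring

/-- Positive weights of average at least `3` split into two balanced parts, or into one part of
weight at least `2 * card ι` and the rest. -/
theorem exists_finset_sum_split {ι : Type} [Fintype ι] [DecidableEq ι] (m : ι → ℕ)
    (hm : ∀ i, 1 ≤ m i) (hι : 2 ≤ Fintype.card ι) (hsum : 3 * Fintype.card ι ≤ ∑ i, m i) :
    ∃ I : Finset ι,
      (Fintype.card ι ≤ ∑ i ∈ I, m i ∧ Fintype.card ι ≤ ∑ i ∈ Iᶜ, m i) ∨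
      (2 * Fintype.card ι ≤ ∑ i ∈ I, m i ∧ Fintype.card ι ≤ ∑ i ∈ Iᶜ, m i + 1) := by
  obtain ⟨I, hI, hmin⟩ := Finset.exists_min_image
    (Finset.univ.filter fun I : Finset ι => Fintype.card ι ≤ ∑ i ∈ I, m i) Finset.card
    ⟨Finset.univ, by simp; omega⟩
  rw [Finset.mem_filter] at hI
  have hne : I.Nonempty := by
    by_contra h
    rw [Finset.not_nonempty_iff_eq_empty] at h
    simp [h] at hI
    omega
  obtain ⟨i, hi⟩ := hne
  have hlt : ∑ j ∈ I.erase i, m j < Fintype.card ι := by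
    by_contra h
    have := hmin (I.erase i) (Finset.mem_filter.2 ⟨Finset.mem_univ _, not_lt.1 h⟩)
    have := Finset.card_erase_lt_of_mem hi
    omega
  have hsI := Finset.add_sum_erase I m hi
  have hcI := Finset.sum_add_sum_compl I m
  have hci := Finset.sum_add_sum_compl {i} m
  rw [Finset.sum_singleton] at hci
  by_cases h2 : 2 * Fintype.card ι ≤ m i
  · refine ⟨{i}, Or.inr ⟨by simpa using h2, ?_⟩⟩
    have h3 : ({i}ᶜ : Finset ι).card • 1 ≤ ∑ j ∈ ({i}ᶜ : Finset ι), m j :=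
      Finset.card_nsmul_le_sum _ _ _ fun j _ => hm j
    rw [Finset.card_compl, Finset.card_singleton, smul_eq_mul] at h3
    omega
  by_cases h1 : Fintype.card ι ≤ m i
  · exact ⟨{i}, Or.inl ⟨by simpa using h1, by omega⟩⟩
  · exact ⟨I, Or.inl ⟨hI.2, by omega⟩⟩

theorem separation_arith {k lam c s b u : ℝ} (hlam : 0 < lam) (hk : 2 * lam ≤ k) (hc : 2 ≤ c)
    (hs : 0 ≤ s) (hle : lam * s ≤ (k - 2 * lam) * c)
    (h : (c ≤ b ∧ c ≤ u) ∨ (2 * c ≤ b ∧ c ≤ u + 1)) :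
    lam ^ 2 * ((s + b) * (s + u)) < k ^ 2 * (b * u) := by
  have hk' : 0 ≤ k - 2 * lam := by linarith
  rcases h with ⟨h1, h2⟩ | ⟨h1, h2⟩
  · have e1 : lam * (s + b) < k * b := by nlinarith
    have e2 : lam * (s + u) < k * u := by nlinarith
    have := mul_lt_mul'' e1 e2 (mul_nonneg hlam.le (by linarith))
      (mul_nonneg hlam.le (by linarith))
    linarith
  · have e1 : lam * (s + b) ≤ k * b / 2 := by nlinarith
    have e2 : lam * (s + u) < 2 * (k * u) := by
      nlinarith [mul_le_mul_of_nonneg_left (show c ≤ 2 * u by linarith) hk']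
    have hb : 0 < k * b / 2 := by
      have : 0 < k * b := mul_pos (by linarith) (by linarith)
      linarith
    have := mul_lt_mul' e1 e2 (mul_nonneg hlam.le (by linarith)) hb
    linarith

/-- The toughness inequality for the fibre of `p` over `none`, when its removal leaves the
fibres over the `some i` with no edges between them. -/
theorem lt_card_fiber_none_of_separation {V ι : Type} [Fintype V] [DecidableEq V]
    [Fintype ι] [DecidableEq ι] (G : SimpleGraph V) {k lam : ℝ} (hlam : 0 < lam)
    (hk : 2 * lam ≤ k)
    (hsep : ∀ B C : Finset V, B.Nonempty → C.Nonempty → (∀ u ∈ B, ∀ v ∈ C, ¬ G.Adj u v) →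
      k ^ 2 * (B.card * C.card) ≤
        lam ^ 2 * ((Fintype.card V - B.card) * (Fintype.card V - C.card)))
    (p : V → Option ι)
    (hp : ∀ u v i j, p u = some i → p v = some j → G.Adj u v → i = j)
    (hsurj : ∀ i, ∃ v, p v = some i) (hι : 2 ≤ Fintype.card ι) :
    (k - 2 * lam) * Fintype.card ι <
      lam * (Finset.univ.filter fun v => p v = none).card := by
  by_contra! hle
  set s := (Finset.univ.filter fun v => p v = none).card with hs
  set c := Fintype.card ι with hc
  let m : ι → ℕ := fun i => (Finset.univ.filter fun v => p v = some i).card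
  have hm (i : ι) : 1 ≤ m i := by
    obtain ⟨v, hv⟩ := hsurj i
    exact Finset.card_pos.2 ⟨v, by simpa using hv⟩
  let U : Finset ι → Finset V := fun I => Finset.univ.filter fun v => ∃ i ∈ I, p v = some i
  have hU (I : Finset ι) : (U I).card = ∑ i ∈ I, m i := by
    have : U I = I.biUnion fun i => Finset.univ.filter fun v => p v = some i := by
      ext v; simp [U]
    rw [this, Finset.card_biUnion]
    intro i _ j _ hij
    rw [Function.onFun, Finset.disjoint_left]
    intro v hv hv'
    simp only [Finset.mem_filter, Finset.mem_univ, true_and] at hv hv'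
    exact hij (Option.some.inj (hv.symm.trans hv'))
  have hn : Fintype.card V = s + ∑ i, m i := by
    rw [← Finset.card_univ, Finset.card_eq_sum_card_fiberwise (f := p) (t := Finset.univ)
      (fun _ _ => Finset.mem_coe.2 (Finset.mem_univ _)), Fintype.sum_option]
  have hcpos : (2 : ℝ) ≤ c := by exact_mod_cast hι
  have hsum : 3 * c ≤ ∑ i, m i := by
    choose r hr using hsurj
    have hinj : Function.Injective r := fun i j h =>
      Option.some.inj ((hr i).symm.trans ((congrArg p h).trans (hr j)))
    have hcard : (Finset.univ.image r).card = c := by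
      rw [Finset.card_image_of_injective _ hinj, Finset.card_univ]
    have hne : (Finset.univ.image r).Nonempty := by
      rw [← Finset.card_pos]; omega
    have h := hsep _ _ hne hne (by
      simp only [Finset.mem_image, Finset.mem_univ, true_and]
      rintro _ ⟨i, rfl⟩ _ ⟨j, rfl⟩ hadj
      have := hp _ _ _ _ (hr i) (hr j) hadj
      subst this
      exact G.loopless.irrefl _ hadj)
    rw [hcard] at h
    have hcn : (c : ℝ) ≤ Fintype.card V := by
      exact_mod_cast hcard ▸ Finset.card_le_univ (Finset.univ.image r)
    have h2 : k * c ≤ lam * (Fintype.card V - c) :=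
      abs_le_of_sq_le_sq' (by nlinarith) (mul_nonneg hlam.le (by linarith)) |>.2
    rw [hn] at h2
    push_cast at h2
    have h3 : lam * (3 * c) ≤ lam * ∑ i, (m i : ℝ) := by linarith
    have := le_of_mul_le_mul_left h3 hlam
    exact_mod_cast this
  obtain ⟨I, hI⟩ := exists_finset_sum_split m hm hι hsum
  have hne (J : Finset ι) (h : 0 < ∑ i ∈ J, m i) : (U J).Nonempty := by
    rwa [← Finset.card_pos, hU]
  have h := hsep (U I) (U Iᶜ) (hne _ (by omega)) (hne _ (by omega)) (by
    simp only [U, Finset.mem_filter, Finset.mem_univ, true_and, Finset.mem_compl]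
    rintro u ⟨i, hi, hui⟩ v ⟨j, hj, hvj⟩ hadj
    exact hj (hp _ _ _ _ hui hvj hadj ▸ hi))
  rw [hU, hU, hn, ← Finset.sum_add_sum_compl I m] at h
  push_cast [← Nat.cast_sum] at h
  refine not_lt.2 ?_ (separation_arith hlam hk hcpos (Nat.cast_nonneg s) hle
    (b := ((∑ i ∈ I, m i : ℕ) : ℝ)) (u := ((∑ i ∈ Iᶜ, m i : ℕ) : ℝ)) (by exact_mod_cast hI))
  calc _ ≤ _ := h
    _ = _ := by ring

theorem card_fiber_none_eq_ncard {V ι : Type} [Fintype V] (p : V → Option ι) (S : Set V)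
    (h : ∀ v, p v = none ↔ v ∈ S) [DecidablePred fun v => p v = none] :
    (Finset.univ.filter fun v => p v = none).card = S.ncard := by
  rw [← Set.ncard_coe_finset]
  congr 1
  ext v
  simp [h]

theorem exists_forall_ne_abs_eigenvalues_le {V : Type} [Fintype V] [DecidableEq V] [Nonempty V]
    (G : SimpleGraph V) [DecidableRel G.Adj] (hA : (G.adjMatrix ℝ).IsHermitian) :
    ∃ i₀, ∀ i ≠ i₀, |hA.eigenvalues i| ≤ max |adjEig G 2| |adjEig G (Fintype.card V)| := by
  refine exists_forall_ne_abs_le_sorted hA.eigenvalues (adjEigs G) ?_ ?_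
  · simp only [adjEigs, Multiset.coe_reverse, Multiset.sort_eq]
    obtain rfl : ‹DecidableRel G.Adj› = fun a b => Classical.propDecidable (G.Adj a b) :=
      Subsingleton.elim _ _
    rfl
  · simp only [adjEigs, List.pairwise_reverse]
    exact Multiset.pairwise_sort _ _

/-- **Brouwer's toughness bound.** If `G` is a connected noncomplete `k`-regular graph
(`k ≥ 1`) on `n` vertices and `λ = max (|λ₂|, |λₙ|)`, then every disconnecting set `S`
satisfies `|S|/c(G − S) > k/λ − 2`; in particular `t(G) > k/λ − 2`. -/
theorem brouwer_toughness_bound {V : Type} [Fintype V] [DecidableEq V]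
    (G : SimpleGraph V) [DecidableRel G.Adj] (k : ℕ) (hk : 1 ≤ k)
    (hreg : G.IsRegularOfDegree k) (hconn : G.Connected) (hnc : G ≠ ⊤)
    (lam : ℝ) (hlam : lam = max |adjEig G 2| |adjEig G (Fintype.card V)|) :
    ∀ S : Set V, 2 ≤ numComp G S →
      (k : ℝ) / lam - 2 < (S.ncard : ℝ) / (numComp G S : ℝ) := by
  classical
  intro S hS
  have hlam0 : 0 ≤ lam := hlam ▸ (abs_nonneg _).trans (le_max_left _ _)
  have hnonneg : (0 : ℝ) ≤ (S.ncard : ℝ) / (numComp G S : ℝ) := by positivity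
  rcases hlam0.eq_or_lt with h0 | hpos
  · rw [← h0, div_zero]; linarith
  by_cases hk2 : (k : ℝ) < 2 * lam
  · linarith [(div_lt_iff₀ hpos).2 hk2]
  rw [not_lt] at hk2
  have : Nonempty V := hconn.nonempty
  have hA : (G.adjMatrix ℝ).IsHermitian := by
    rw [Matrix.IsHermitian, Matrix.conjTranspose_eq_transpose_of_trivial]
    exact G.isSymm_adjMatrix
  obtain ⟨i₀, hi₀⟩ := exists_forall_ne_abs_eigenvalues_le G hA
  rw [← hlam] at hi₀
  have hsep := fun (B C : Finset V) hB hC hBC => card_mul_card_le_of_no_edges hreg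
    (fun f hf => mulVec_dotProduct_self_le_of_orthogonal hA (k := k) (by linarith)
      (adjMatrix_mulVec_one hreg) hi₀ hf)
    (B := B) (C := C) hB hC hBC
  let p : V → Option (G.induce Sᶜ).ConnectedComponent := fun v =>
    if h : v ∈ Sᶜ then some ((G.induce Sᶜ).connectedComponentMk ⟨v, h⟩) else none
  have hpsome (v : V) (i) (hv : p v = some i) :
      ∃ h : v ∈ Sᶜ, (G.induce Sᶜ).connectedComponentMk ⟨v, h⟩ = i := by
    by_cases h : v ∈ Sᶜ
    · exact ⟨h, by simpa only [p, dif_pos h, Option.some.injEq] using hv⟩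
    · simp only [p, dif_neg h, reduceCtorEq] at hv
  have hp (u v : V) (i j) (hu : p u = some i) (hv : p v = some j) (hadj : G.Adj u v) : i = j := by
    obtain ⟨hu, rfl⟩ := hpsome u i hu
    obtain ⟨hv, rfl⟩ := hpsome v j hv
    exact ConnectedComponent.connectedComponentMk_eq_of_adj (by simpa using hadj)
  have hsurj (i) : ∃ v, p v = some i := by
    induction i using ConnectedComponent.ind with
    | h v => exact ⟨v.1, dif_pos v.2⟩
  have hcard : numComp G S = Fintype.card (G.induce Sᶜ).ConnectedComponent :=
    Nat.card_eq_fintype_card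
  have hmain := lt_card_fiber_none_of_separation G hpos hk2 hsep p hp hsurj (hcard ▸ hS)
  rw [card_fiber_none_eq_ncard p S (fun v => by by_cases h : v ∈ S <;> simp [p, h]),
    ← hcard] at hmain
  have hc : (0 : ℝ) < numComp G S := by exact_mod_cast (by omega : 0 < numComp G S)
  rw [lt_div_iff₀ hc]
  refine lt_of_mul_lt_mul_left ?_ hlam0
  calc lam * (((k : ℝ) / lam - 2) * numComp G S) = (k - 2 * lam) * numComp G S := by
        field_simp
    _ < _ := hmain
end

section
/- Let G be a connected k-regular finite simple graph with k ≥ 3. If k is odd and λ_2(G) < (k − 2 + √(k² + 8))/2, or if k is even and λ_2(G) < (k − 2 + √(k² + 12))/2, then every disconnecting set S of G satisfies |S| ≥ c(G − S); that is, G is 1-tough. -/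
open SimpleGraph Matrix

section Spectral

variable {V : Type} [Fintype V] [DecidableEq V]

/-- If the second entry of a decreasingly sorted list is below `t`, at most one entry is at
least `t`. -/
lemma countP_le_one_of_getD_one_lt {l : List ℝ} (hl : l.Pairwise (· ≥ ·)) {t : ℝ}
    (h : l.getD 1 0 < t) : l.countP (fun a => t ≤ a) ≤ 1 := by
  match l, hl, h with
  | [], _, _ => simp
  | [a], _, _ => exact List.countP_le_length
  | a :: b :: l, hl, h =>
    have hb : b < t := by simpa using h
    rw [List.pairwise_cons, List.pairwise_cons] at hl
    have h0 : (b :: l).countP (fun a => t ≤ a) = 0 := by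
      rw [List.countP_eq_zero]
      intro c hc
      rcases List.mem_cons.1 hc with rfl | hc
      · simpa using hb
      · simpa using (hl.2.1 c hc).trans_lt hb
    rw [List.countP_cons, h0]
    split_ifs <;> simp

/-- If `λ₂ < t` then at most one index carries an eigenvalue that is at least `t`. -/
lemma eigenvalues_subsingleton_of_adjEig_two_lt (G : SimpleGraph V) [inst : DecidableRel G.Adj]
    (hA : (G.adjMatrix ℝ).IsHermitian) {t : ℝ} (h : adjEig G 2 < t) {i j : V}
    (hi : t ≤ hA.eigenvalues i) (hj : t ≤ hA.eigenvalues j) : i = j := by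
  obtain rfl : inst = fun a b => Classical.propDecidable _ := Subsingleton.elim _ _
  have hcount := countP_le_one_of_getD_one_lt (l := adjEigs G) (by
    unfold adjEigs
    rw [List.pairwise_reverse]
    exact Multiset.pairwise_sort _ _) (t := t) h
  have hcard : (Finset.univ.filter fun i => t ≤ hA.eigenvalues i).card ≤ 1 := by
    refine le_trans (le_of_eq ?_) hcount
    unfold adjEigs
    rw [List.countP_reverse, ← Multiset.coe_countP, Multiset.sort_eq, Multiset.countP_map]
    rfl
  exact Finset.card_le_one.1 hcard i (by simpa using hi) j (by simpa using hj)

/-- A real symmetric matrix whose eigenvalues, apart from that of index `j`, lie below `t` has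
quadratic form below `t` on the nonzero vectors orthogonal to the `j`-th eigenvector. -/
lemma dotProduct_mulVec_lt_of_eigenvalues_lt {A : Matrix V V ℝ} (hA : A.IsHermitian) {t : ℝ}
    (j : V) (hj : ∀ i, i ≠ j → hA.eigenvalues i < t) {z : V → ℝ} (hz : z ≠ 0)
    (hzj : z ⬝ᵥ (hA.eigenvectorBasis j).ofLp = 0) :
    z ⬝ᵥ A *ᵥ z < t * (z ⬝ᵥ z) := by
  set b := hA.eigenvectorBasis with hb
  have key : ∀ x y : V → ℝ, x ⬝ᵥ y = ∑ i, (x ⬝ᵥ (b i).ofLp) * (y ⬝ᵥ (b i).ofLp) := by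
    intro x y
    have := b.sum_inner_mul_inner (WithLp.toLp 2 x) (WithLp.toLp 2 y)
    simp only [EuclideanSpace.inner_eq_star_dotProduct, star_trivial] at this
    rw [dotProduct_comm x y, ← this]
    exact Finset.sum_congr rfl fun i _ => by rw [dotProduct_comm x]
  have hAz : ∀ i, (A *ᵥ z) ⬝ᵥ (b i).ofLp = hA.eigenvalues i * (z ⬝ᵥ (b i).ofLp) := by
    intro i
    have hT : Aᵀ = A := by simpa [Matrix.conjTranspose_eq_transpose_of_trivial] using hA.eq
    rw [dotProduct_comm, dotProduct_mulVec, ← mulVec_transpose, hT, hA.mulVec_eigenvectorBasis,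
      smul_dotProduct, dotProduct_comm, smul_eq_mul]
  rw [key z (A *ᵥ z), key z z, Finset.mul_sum]
  simp only [hAz]
  have hex : ∃ i, z ⬝ᵥ (b i).ofLp ≠ 0 := by
    by_contra! hall
    apply hz
    rw [← dotProduct_self_eq_zero, key]
    simp [hall]
  obtain ⟨i, hi⟩ := hex
  refine Finset.sum_lt_sum (fun i _ => ?_) ⟨i, Finset.mem_univ _, ?_⟩
  · by_cases hij : i = j
    · subst hij; simp [hzj]
    · nlinarith [hj i hij, mul_self_nonneg (z ⬝ᵥ (b i).ofLp)]
  · have hij : i ≠ j := by rintro rfl; exact hi hzj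
    nlinarith [hj i hij, mul_self_pos.2 hi]

/-- Two vectors with disjoint supports, no adjacency between them and Rayleigh quotients at least
`t` force `t ≤ λ₂`. -/
lemma le_adjEig_two (G : SimpleGraph V) [DecidableRel G.Adj] {t : ℝ} {x y : V → ℝ}
    (hx : x ≠ 0) (hy : y ≠ 0) (hxy : x ⬝ᵥ y = 0) (hxAy : x ⬝ᵥ G.adjMatrix ℝ *ᵥ y = 0)
    (hxt : t * (x ⬝ᵥ x) ≤ x ⬝ᵥ G.adjMatrix ℝ *ᵥ x)
    (hyt : t * (y ⬝ᵥ y) ≤ y ⬝ᵥ G.adjMatrix ℝ *ᵥ y) : t ≤ adjEig G 2 := by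
  by_contra! hlt
  set A := G.adjMatrix ℝ with hAdef
  have hT : Aᵀ = A := G.isSymm_adjMatrix
  have hA : A.IsHermitian := by
    rw [Matrix.IsHermitian, Matrix.conjTranspose_eq_transpose_of_trivial, hT]
  have hj : ∃ j, ∀ i, i ≠ j → hA.eigenvalues i < t := by
    by_cases h : ∃ j, t ≤ hA.eigenvalues j
    · obtain ⟨j, hj⟩ := h
      refine ⟨j, fun i hij => ?_⟩
      by_contra! hi
      exact hij (eigenvalues_subsingleton_of_adjEig_two_lt G hA hlt hi hj)
    · push Not at h
      obtain ⟨j, -⟩ := Function.ne_iff.1 hx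
      exact ⟨j, fun i _ => h i⟩
  obtain ⟨j, hj⟩ := hj
  set w := (hA.eigenvectorBasis j).ofLp
  have hyAx : y ⬝ᵥ A *ᵥ x = 0 := by
    rw [dotProduct_mulVec, ← mulVec_transpose, hT, dotProduct_comm, hxAy]
  have hyx : y ⬝ᵥ x = 0 := by rw [dotProduct_comm, hxy]
  have hxpos : 0 < x ⬝ᵥ x := lt_of_le_of_ne (by simpa using dotProduct_star_self_nonneg x)
    (Ne.symm (by simpa [dotProduct_self_eq_zero] using hx))
  have hypos : 0 < y ⬝ᵥ y := lt_of_le_of_ne (by simpa using dotProduct_star_self_nonneg y)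
    (Ne.symm (by simpa [dotProduct_self_eq_zero] using hy))
  have hcomb : ∀ α β : ℝ, (α ≠ 0 ∨ β ≠ 0) → α * (x ⬝ᵥ w) + β * (y ⬝ᵥ w) ≠ 0 := by
    intro α β hαβ h0
    have hzz : (α • x + β • y) ⬝ᵥ (α • x + β • y)
        = α ^ 2 * (x ⬝ᵥ x) + β ^ 2 * (y ⬝ᵥ y) := by
      simp only [add_dotProduct, dotProduct_add, smul_dotProduct, dotProduct_smul, smul_eq_mul,
        hxy, hyx]
      ring
    have hzAz : (α • x + β • y) ⬝ᵥ A *ᵥ (α • x + β • y)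
        = α ^ 2 * (x ⬝ᵥ A *ᵥ x) + β ^ 2 * (y ⬝ᵥ A *ᵥ y) := by
      simp only [mulVec_add, mulVec_smul, add_dotProduct, dotProduct_add, smul_dotProduct,
        dotProduct_smul, smul_eq_mul, hxAy, hyAx]
      ring
    have hz : α • x + β • y ≠ 0 := by
      intro hz
      rw [hz, zero_dotProduct] at hzz
      rcases hαβ with h | h
      · nlinarith [mul_pos (pow_pos (abs_pos.2 h) 2) hxpos, sq_abs α,
          mul_nonneg (sq_nonneg β) hypos.le]
      · nlinarith [mul_pos (pow_pos (abs_pos.2 h) 2) hypos, sq_abs β,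
          mul_nonneg (sq_nonneg α) hxpos.le]
    have := dotProduct_mulVec_lt_of_eigenvalues_lt hA j hj hz (by
      simpa [add_dotProduct, smul_dotProduct] using h0)
    rw [hzz, hzAz] at this
    nlinarith [mul_le_mul_of_nonneg_left hxt (sq_nonneg α),
      mul_le_mul_of_nonneg_left hyt (sq_nonneg β)]
  by_cases hxw : x ⬝ᵥ w = 0
  · exact hcomb 1 0 (by simp) (by simp [hxw])
  · exact hcomb (-(y ⬝ᵥ w)) (x ⬝ᵥ w) (Or.inr hxw) (by ring)

end Spectral

section EdgeCount

variable {V : Type} (G : SimpleGraph V) [DecidableRel G.Adj]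

/-- The number of ordered adjacent pairs in `X × Y`. -/
def edgeCount (X Y : Finset V) : ℕ :=
  ∑ u ∈ X, ∑ v ∈ Y, if G.Adj u v then 1 else 0

lemma edgeCount_comm (X Y : Finset V) : edgeCount G X Y = edgeCount G Y X := by
  unfold edgeCount
  rw [Finset.sum_comm]
  simp only [G.adj_comm]

lemma even_edgeCount_self (C : Finset V) : Even (edgeCount G C C) := by
  rw [← ZMod.natCast_eq_zero_iff_even, edgeCount, ← Finset.sum_product']
  push_cast
  refine Finset.sum_involution (fun p _ => p.swap) ?_ ?_ ?_ ?_
  · rintro ⟨u, v⟩ -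
    simp only [Prod.swap, G.adj_comm v u]
    exact CharTwo.add_self_eq_zero _
  · rintro ⟨u, v⟩ - h heq
    simp only [Prod.swap, Prod.mk.injEq] at heq
    simp [heq.1] at h
  · rintro ⟨u, v⟩ h
    simpa [and_comm] using h
  · simp

variable [Fintype V] [DecidableEq V]

/-- The real-valued indicator vector of a set of vertices. -/
def indVec (X : Finset V) : V → ℝ := fun v => if v ∈ X then 1 else 0

lemma indVec_dotProduct_indVec (X Y : Finset V) :
    indVec X ⬝ᵥ indVec Y = ((X ∩ Y).card : ℝ) := by
  simp [indVec, dotProduct, ← Finset.mem_inter, ← ite_and, Finset.inter_comm]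

lemma indVec_dotProduct_adjMatrix (X Y : Finset V) :
    indVec X ⬝ᵥ G.adjMatrix ℝ *ᵥ indVec Y = (edgeCount G X Y : ℝ) := by
  simp only [indVec, dotProduct, mulVec, edgeCount, adjMatrix_apply, mul_ite, mul_one, mul_zero,
    ite_mul, one_mul, zero_mul, Finset.sum_ite_mem, Finset.univ_inter]
  push_cast
  rfl

lemma edgeCount_eq_sum_card (X Y : Finset V) :
    edgeCount G X Y = ∑ u ∈ X, (G.neighborFinset u ∩ Y).card := by
  refine Finset.sum_congr rfl fun u _ => ?_
  rw [Finset.sum_boole, Nat.cast_id, Finset.inter_comm]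
  congr 1
  ext v
  simp

lemma edgeCount_self_add_compl {k : ℕ} (hreg : G.IsRegularOfDegree k) (C : Finset V) :
    edgeCount G C C + edgeCount G C Cᶜ = k * C.card := by
  rw [edgeCount_eq_sum_card, edgeCount_eq_sum_card, ← Finset.sum_add_distrib, mul_comm,
    ← smul_eq_mul, ← Finset.sum_const]
  refine Finset.sum_congr rfl fun u _ => ?_
  rw [← hreg u, ← G.card_neighborFinset_eq_degree, ← Finset.sdiff_eq_inter_compl,
    Finset.card_inter_add_card_sdiff]

/-- In a `k`-regular graph a nonempty vertex set with fewer than `k` outgoing edges has more than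
`k` vertices. -/
lemma lt_card_of_edgeCount_compl_lt {k : ℕ} (hreg : G.IsRegularOfDegree k) {C : Finset V}
    (hC : C.Nonempty) (he : edgeCount G C Cᶜ < k) : k < C.card := by
  by_contra! hle
  have hself : edgeCount G C C ≤ C.card * (C.card - 1) := by
    rw [edgeCount_eq_sum_card, ← smul_eq_mul]
    refine Finset.sum_le_card_nsmul _ _ _ fun u hu => ?_
    rw [← Finset.card_erase_of_mem hu]
    refine Finset.card_le_card fun v hv => ?_
    simp only [Finset.mem_inter, mem_neighborFinset] at hv
    exact Finset.mem_erase.2 ⟨hv.1.ne', hv.2⟩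
  have hsum := edgeCount_self_add_compl G hreg C
  obtain ⟨n, hn⟩ : ∃ n, C.card = n + 1 := ⟨C.card - 1, by have := hC.card_pos; omega⟩
  rw [hn] at hself hsum hle
  simp only [Nat.add_sub_cancel] at hself
  nlinarith

/-- A vertex set whose size exceeds its number of outgoing edges by at least `r` contains `r`
vertices without neighbours outside. -/
lemma exists_subset_no_outside_neighbor {C : Finset V} {r : ℕ}
    (h : r + edgeCount G C Cᶜ ≤ C.card) :
    ∃ T ⊆ C, T.card = r ∧ ∀ u ∈ T, G.neighborFinset u ⊆ C := by
  have hbad : (C.filter fun u => ¬ G.neighborFinset u ⊆ C).card ≤ edgeCount G C Cᶜ := by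
    rw [edgeCount_eq_sum_card, Finset.card_filter]
    refine Finset.sum_le_sum fun u _ => ?_
    split_ifs with hu
    · exact Nat.zero_le _
    · rw [Nat.one_le_iff_ne_zero, Finset.card_ne_zero, ← Finset.sdiff_eq_inter_compl,
        Finset.sdiff_nonempty]
      exact hu
  have hsplit := Finset.card_filter_add_card_filter_not (s := C)
    (fun u => G.neighborFinset u ⊆ C)
  obtain ⟨T, hT, hcard⟩ := Finset.exists_subset_card_eq
    (s := C.filter fun u => G.neighborFinset u ⊆ C) (n := r) (by omega)
  exact ⟨T, hT.trans (Finset.filter_subset _ _), hcard, fun u hu => (Finset.mem_filter.1 (hT hu)).2⟩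

/-- A vertex set of a `k`-regular graph with at most `k - m` outgoing edges carries a vector whose
Rayleigh quotient is at least the larger root of `t² - (k - 2) t - (k + m)`. -/
lemma exists_vector_of_edgeCount_compl_le {k m : ℕ} (hreg : G.IsRegularOfDegree k) (hm : 0 < m)
    (hmk : m < k) {C : Finset V} (hC : C.Nonempty) (he : edgeCount G C Cᶜ + m ≤ k) {t : ℝ}
    (ht : t = ((k : ℝ) - 2 + √((k : ℝ) ^ 2 + 4 * (m + 1))) / 2) :
    ∃ x : V → ℝ, x ≠ 0 ∧ (∀ v ∉ C, x v = 0) ∧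
      t * (x ⬝ᵥ x) ≤ x ⬝ᵥ G.adjMatrix ℝ *ᵥ x := by
  have hcard : k < C.card := lt_card_of_edgeCount_compl_lt G hreg hC (by omega)
  have hsum := edgeCount_self_add_compl G hreg C
  have hm' : (0 : ℝ) < m := by exact_mod_cast hm
  have hmk' : (m : ℝ) < k := by exact_mod_cast hmk
  have hsumR : (edgeCount G C C : ℝ) + edgeCount G C Cᶜ = k * C.card := by exact_mod_cast hsum
  have heR : (edgeCount G C Cᶜ : ℝ) + m ≤ k := by exact_mod_cast he
  have hsq : √((k : ℝ) ^ 2 + 4 * (m + 1)) ^ 2 = (k : ℝ) ^ 2 + 4 * (m + 1) :=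
    Real.sq_sqrt (by positivity)
  have hquad : t ^ 2 = (k - 2) * t + (k + m) := by
    rw [ht]; linear_combination hsq / 4
  have hindne : indVec C ≠ 0 := by
    obtain ⟨v, hv⟩ := hC
    exact Function.ne_iff.2 ⟨v, by simp [indVec, hv]⟩
  obtain hlarge | hsmall : k + 2 ≤ C.card ∨ C.card = k + 1 := by omega
  · refine ⟨indVec C, hindne, fun v hv => if_neg hv, ?_⟩
    rw [indVec_dotProduct_indVec, indVec_dotProduct_adjMatrix, Finset.inter_self]
    have hlargeR : (k : ℝ) + 2 ≤ C.card := by exact_mod_cast hlarge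
    have hk2 : (0 : ℝ) < k + 2 := by positivity
    have hroot : √((k : ℝ) ^ 2 + 4 * (m + 1)) ≤ k + 2 * (m + 2) / (k + 2) := by
      rw [Real.sqrt_le_left (by positivity)]
      have : (k + 2 * (m + 2) / (k + 2) : ℝ) ^ 2 - ((k : ℝ) ^ 2 + 4 * (m + 1))
          = 4 * (k - m) ^ 2 / (k + 2) ^ 2 := by
        field_simp; ring
      have : 0 ≤ 4 * ((k : ℝ) - m) ^ 2 / (k + 2) ^ 2 := by positivity
      linarith
    have htk : t * (k + 2) ≤ k ^ 2 + k + m := by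
      have : (k + 2 * (m + 2) / (k + 2) : ℝ) * (k + 2) = k * (k + 2) + 2 * (m + 2) := by
        field_simp
      rw [ht]
      nlinarith [mul_le_mul_of_nonneg_right hroot hk2.le]
    have hlt : t ≤ k := by nlinarith
    nlinarith [mul_le_mul_of_nonneg_left hlargeR (sub_nonneg.2 hlt)]
  · obtain ⟨T, hTC, hTcard, hT⟩ := exists_subset_no_outside_neighbor G (C := C) (r := m + 1)
      (by omega)
    have hTCcount : edgeCount G T C = (m + 1) * k := by
      rw [edgeCount_eq_sum_card, ← hTcard, ← smul_eq_mul, ← Finset.sum_const]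
      refine Finset.sum_congr rfl fun u hu => ?_
      rw [Finset.inter_eq_left.2 (hT u hu), G.card_neighborFinset_eq_degree, hreg u]
    have hTTcount : edgeCount G T T = (m + 1) * m := by
      rw [edgeCount_eq_sum_card, ← hTcard, ← smul_eq_mul, ← Finset.sum_const]
      refine Finset.sum_congr rfl fun u hu => ?_
      have hN : G.neighborFinset u = C.erase u := by
        refine Finset.eq_of_subset_of_card_le (fun v hv => Finset.mem_erase.2
          ⟨((G.mem_neighborFinset u v).1 hv).ne', hT u hu hv⟩) ?_
        rw [Finset.card_erase_of_mem (hTC hu), G.card_neighborFinset_eq_degree, hreg u, hsmall]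
        simp
      have : C.erase u ∩ T = T.erase u := by
        rw [Finset.erase_inter, Finset.inter_eq_right.2 hTC]
      rw [hN, this, Finset.card_erase_of_mem hu, hTcard, Nat.add_sub_cancel]
    set b : ℝ := t - m with hb
    set a : ℝ := k - m with ha
    refine ⟨b • indVec C + (a - b) • indVec T, ?_, ?_, ?_⟩
    · obtain ⟨v, hv⟩ : T.Nonempty := Finset.card_pos.1 (by omega)
      exact Function.ne_iff.2 ⟨v, by simp [indVec, hv, hTC hv, ha, sub_ne_zero, hmk'.ne']⟩
    · intro v hv
      have hvT : v ∉ T := fun h => hv (hTC h)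
      simp [indVec, hv, hvT]
    · simp only [mulVec_add, mulVec_smul, add_dotProduct, dotProduct_add, smul_dotProduct,
        dotProduct_smul, smul_eq_mul, indVec_dotProduct_indVec, indVec_dotProduct_adjMatrix,
        Finset.inter_self, Finset.inter_eq_left.2 hTC, Finset.inter_eq_right.2 hTC,
        edgeCount_comm G C T, hTCcount, hTTcount, hTcard, hsmall]
      have hCC : (edgeCount G C C : ℝ) = k * (k + 1) - edgeCount G C Cᶜ := by
        rw [hsmall] at hsumR; push_cast at hsumR; linarith
      rw [hCC]
      push_cast
      have : (b * ((b * (k * (k + 1) - k + m)) + (a - b) * ((m + 1) * k))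
        + (a - b) * (b * ((m + 1) * k) + (a - b) * ((m + 1) * m)))
        - t * (b * (b * (k + 1) + (a - b) * (m + 1)) + (a - b) * (b * (m + 1) + (a - b) * (m + 1)))
        = 0 := by
        rw [ha, hb]
        linear_combination (-((k : ℝ) - m) * (t - m)) * hquad
      nlinarith [mul_le_mul_of_nonneg_left heR (mul_self_nonneg b)]

end EdgeCount

section Components

variable {V : Type} [Fintype V] [DecidableEq V] (G : SimpleGraph V) [DecidableRel G.Adj]

/-- A nonempty proper vertex set of a connected graph has an outgoing edge. -/
lemma edgeCount_compl_pos (hconn : G.Connected) {C : Finset V} (hC : C.Nonempty)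
    (hne : C ≠ Finset.univ) : 0 < edgeCount G C Cᶜ := by
  rw [Nat.pos_iff_ne_zero]
  intro h0
  have hclosed : ∀ u ∈ C, ∀ v, G.Adj u v → v ∈ C := by
    intro u hu v huv
    by_contra hv
    simp only [edgeCount, Finset.sum_eq_zero_iff] at h0
    simpa [huv] using h0 u hu v (Finset.mem_compl.2 hv)
  obtain ⟨u, hu⟩ := hC
  refine hne (Finset.eq_univ_iff_forall.2 fun v => ?_)
  obtain ⟨p⟩ := hconn.preconnected u v
  induction p with
  | nil => exact hu
  | cons h _ ih => exact ih (hclosed _ hu _ h)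

/-- If deleting `S` from a connected `k`-regular graph leaves more than `|S|` pieces, then two of
the pieces have fewer than `k` outgoing edges. -/
lemma exists_two_edgeCount_compl_lt {ι : Type*} [Fintype ι] [DecidableEq ι] {k : ℕ}
    (hreg : G.IsRegularOfDegree k) (hconn : G.Connected) {S : Finset V} {F : ι → Finset V}
    (hne : ∀ i, (F i).Nonempty) (hdisj : Pairwise fun i j => Disjoint (F i) (F j))
    (hnbr : ∀ i, ∀ u ∈ F i, ∀ v, G.Adj u v → v ∈ F i ∨ v ∈ S)
    (htwo : 2 ≤ Fintype.card ι) (hcard : S.card < Fintype.card ι) :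
    ∃ i j, i ≠ j ∧ edgeCount G (F i) (F i)ᶜ < k ∧ edgeCount G (F j) (F j)ᶜ < k := by
  have hpos : ∀ i, 0 < edgeCount G (F i) (F i)ᶜ := by
    intro i
    refine edgeCount_compl_pos G hconn (hne i) fun huniv => ?_
    have : Nontrivial ι := Fintype.one_lt_card_iff_nontrivial.1 htwo
    obtain ⟨j, hj⟩ := exists_ne i
    obtain ⟨v, hv⟩ := hne j
    exact Finset.disjoint_left.1 (hdisj hj) hv (huniv ▸ Finset.mem_univ v)
  have hle : ∑ i, edgeCount G (F i) (F i)ᶜ ≤ S.card * k := by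
    calc ∑ i, edgeCount G (F i) (F i)ᶜ ≤ ∑ i, edgeCount G S (F i) := by
          refine Finset.sum_le_sum fun i _ => ?_
          rw [edgeCount_comm G S, edgeCount_eq_sum_card, edgeCount_eq_sum_card]
          refine Finset.sum_le_sum fun u hu => Finset.card_le_card fun v hv => ?_
          simp only [Finset.mem_inter, mem_neighborFinset, Finset.mem_compl] at hv ⊢
          exact ⟨hv.1, (hnbr i u hu v hv.1).resolve_left hv.2⟩
      _ = ∑ u ∈ S, ∑ i, (G.neighborFinset u ∩ F i).card := by
          simp only [edgeCount_eq_sum_card]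
          exact Finset.sum_comm
      _ ≤ S.card * k := by
          rw [← smul_eq_mul]
          refine Finset.sum_le_card_nsmul _ _ _ fun u _ => ?_
          rw [← Finset.card_biUnion fun i _ j _ hij =>
            (hdisj hij).mono Finset.inter_subset_right Finset.inter_subset_right]
          rw [← hreg u, ← G.card_neighborFinset_eq_degree]
          exact Finset.card_le_card (Finset.biUnion_subset.2 fun i _ => Finset.inter_subset_left)
  by_contra! hcon
  have hone : ∃ i, ∀ j, j ≠ i → k ≤ edgeCount G (F j) (F j)ᶜ := by
    by_cases h : ∃ i, edgeCount G (F i) (F i)ᶜ < k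
    · obtain ⟨i, hi⟩ := h
      exact ⟨i, fun j hj => hcon i j hj.symm hi⟩
    · push Not at h
      obtain ⟨i⟩ : Nonempty ι := Fintype.card_pos_iff.1 (by omega)
      exact ⟨i, fun j _ => h j⟩
  obtain ⟨i, hi⟩ := hone
  have hrest : (Fintype.card ι - 1) * k ≤ ∑ j ∈ Finset.univ.erase i, edgeCount G (F j) (F j)ᶜ := by
    rw [← Finset.card_univ, ← Finset.card_erase_of_mem (Finset.mem_univ i), ← smul_eq_mul]
    exact Finset.card_nsmul_le_sum _ _ _ fun j hj => hi j (Finset.ne_of_mem_erase hj)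
  have hsplit := Finset.add_sum_erase Finset.univ (fun j => edgeCount G (F j) (F j)ᶜ)
    (Finset.mem_univ i)
  have hmul : S.card * k ≤ (Fintype.card ι - 1) * k := Nat.mul_le_mul_right k (by omega)
  have := hpos i
  omega

/-- Two disjoint nonadjacent vertex sets with at most `k - m` outgoing edges each bound `λ₂` from
below. -/
lemma le_adjEig_two_of_edgeCount_compl_le {k m : ℕ} (hreg : G.IsRegularOfDegree k) (hm : 0 < m)
    (hmk : m < k) {C D : Finset V} (hC : C.Nonempty) (hD : D.Nonempty) (hCD : Disjoint C D)
    (hadj : ∀ u ∈ C, ∀ v ∈ D, ¬ G.Adj u v) (heC : edgeCount G C Cᶜ + m ≤ k)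
    (heD : edgeCount G D Dᶜ + m ≤ k) :
    ((k : ℝ) - 2 + √((k : ℝ) ^ 2 + 4 * (m + 1))) / 2 ≤ adjEig G 2 := by
  obtain ⟨x, hx, hxC, hxt⟩ := exists_vector_of_edgeCount_compl_le G hreg hm hmk hC heC rfl
  obtain ⟨y, hy, hyD, hyt⟩ := exists_vector_of_edgeCount_compl_le G hreg hm hmk hD heD rfl
  refine le_adjEig_two G hx hy ?_ ?_ hxt hyt
  · refine Finset.sum_eq_zero fun v _ => ?_
    by_cases hv : v ∈ C
    · rw [hyD v (Finset.disjoint_left.1 hCD hv), mul_zero]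
    · rw [hxC v hv, zero_mul]
  · refine Finset.sum_eq_zero fun u _ => ?_
    by_cases hu : u ∈ C
    · refine mul_eq_zero_of_right _ (Finset.sum_eq_zero fun v _ => ?_)
      by_cases hv : v ∈ D
      · simp [hadj u hu v hv]
      · rw [hyD v hv, mul_zero]
    · rw [hxC u hu, zero_mul]

end Components

/-- If `G` is a connected `k`-regular graph (`k ≥ 3`) with
`λ₂(G) < (k − 2 + √(k² + 8))/2` when `k` is odd, or
`λ₂(G) < (k − 2 + √(k² + 12))/2` when `k` is even, then every disconnecting set `S`
satisfies `|S| ≥ c(G − S)`; that is, `G` is `1`-tough. -/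
theorem one_tough_of_lambda_two_lt {V : Type} [Fintype V] [DecidableEq V]
    (G : SimpleGraph V) [DecidableRel G.Adj] (k : ℕ) (hk : 3 ≤ k)
    (hreg : G.IsRegularOfDegree k) (hconn : G.Connected)
    (hlam : (Odd k ∧ adjEig G 2 < ((k : ℝ) - 2 + Real.sqrt ((k : ℝ) ^ 2 + 8)) / 2) ∨
            (Even k ∧ adjEig G 2 < ((k : ℝ) - 2 + Real.sqrt ((k : ℝ) ^ 2 + 12)) / 2)) :
    ∀ S : Set V, 2 ≤ numComp G S → numComp G S ≤ S.ncard := by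
  classical
  intro S htwo
  by_contra! hlt
  let H := G.induce Sᶜ
  have : Fintype H.ConnectedComponent := Fintype.ofFinite _
  let F : H.ConnectedComponent → Finset V := fun c =>
    Finset.univ.filter fun v => ∃ h : v ∈ Sᶜ, H.connectedComponentMk ⟨v, h⟩ = c
  have hmem : ∀ c v, v ∈ F c ↔ ∃ h : v ∈ Sᶜ, H.connectedComponentMk ⟨v, h⟩ = c := by simp [F]
  have hne : ∀ c, (F c).Nonempty := by
    intro c
    induction c using SimpleGraph.ConnectedComponent.ind with
    | h v => exact ⟨v, (hmem _ _).2 ⟨v.2, rfl⟩⟩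
  have hdisj : Pairwise fun c d => Disjoint (F c) (F d) := by
    intro c d hcd
    refine Finset.disjoint_left.2 fun v hc hd => hcd ?_
    obtain ⟨_, rfl⟩ := (hmem _ _).1 hc
    obtain ⟨_, rfl⟩ := (hmem _ _).1 hd
    rfl
  have hnbr : ∀ c, ∀ u ∈ F c, ∀ v, G.Adj u v → v ∈ F c ∨ v ∈ S.toFinset := by
    intro c u hu v huv
    obtain ⟨hu', rfl⟩ := (hmem _ _).1 hu
    by_cases hv : v ∈ S
    · exact Or.inr (by simpa using hv)
    · refine Or.inl ((hmem _ _).2 ⟨hv, ConnectedComponent.sound (Adj.reachable ?_)⟩)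
      exact huv.symm
  unfold numComp at htwo hlt
  rw [Nat.card_eq_fintype_card] at htwo hlt
  rw [Set.ncard_eq_toFinset_card'] at hlt
  obtain ⟨c, d, hcd, hc, hd⟩ :=
    exists_two_edgeCount_compl_lt G hreg hconn hne hdisj hnbr htwo hlt
  have hadj : ∀ u ∈ F c, ∀ v ∈ F d, ¬ G.Adj u v := by
    intro u hu v hv huv
    rcases hnbr c u hu v huv with h | h
    · exact Finset.disjoint_left.1 (hdisj hcd) h hv
    · obtain ⟨hv', -⟩ := (hmem _ _).1 hv
      exact hv' (by simpa using h)
  rcases hlam with ⟨-, hlam⟩ | ⟨heven, hlam⟩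
  · have hle := le_adjEig_two_of_edgeCount_compl_le G hreg one_pos (by omega) (hne c) (hne d)
      (hdisj hcd) hadj hc hd
    norm_num at hle
    linarith
  · have hparity : ∀ C : Finset V, edgeCount G C Cᶜ < k → edgeCount G C Cᶜ + 2 ≤ k := by
      intro C hC
      have hsum := edgeCount_self_add_compl G hreg C
      have heC : Even (edgeCount G C Cᶜ) :=
        (Nat.even_add.1 (hsum ▸ heven.mul_right _)).1 (even_edgeCount_self G C)
      obtain ⟨a, ha⟩ := heC
      obtain ⟨b, hb⟩ := heven
      omega
    have hle := le_adjEig_two_of_edgeCount_compl_le G hreg two_pos (by omega) (hne c) (hne d)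
      (hdisj hcd) hadj (hparity _ hc) (hparity _ hd)
    norm_num at hle
    linarith
end

section
/- For every integer k ≥ 2 there exists a connected bipartite k-regular finite simple graph G admitting a disconnecting set S of size 2 with c(G − S) = k; in particular t(G) ≤ 2/k. -/
open SimpleGraph Matrix

/-- The bipartite graph made of `k` copies of `K_{k,k}` minus an edge, indexed by the first
coordinate, and two further vertices `(none, true)` and `(none, false)`, each joined to the
endpoint of every missing edge on the opposite side. The Boolean is the side of the bipartition. -/
def brokenBicliques (k : ℕ) [NeZero k] : SimpleGraph (Option (Fin k × Fin k) × Bool) where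
  Adj x y := x.2 ≠ y.2 ∧
    match x.1, y.1 with
    | none, none => False
    | none, some q => q.2 = 0
    | some p, none => p.2 = 0
    | some p, some q => p.1 = q.1 ∧ ¬ (p.2 = 0 ∧ q.2 = 0)
  symm := ⟨by
    rintro ⟨_ | p, b⟩ ⟨_ | q, c⟩ ⟨h, h'⟩
    · exact h'.elim
    · exact ⟨h.symm, h'⟩
    · exact ⟨h.symm, h'⟩
    · exact ⟨h.symm, h'.1.symm, fun h0 => h'.2 h0.symm⟩⟩
  loopless := ⟨fun _ h => h.1 rfl⟩

namespace brokenBicliques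

/-- The two vertices of `brokenBicliques k` outside the copies of `K_{k,k}` minus an edge. -/
def hubs (k : ℕ) : Set (Option (Fin k × Fin k) × Bool) :=
  {(none, true), (none, false)}

lemma notMem_hubs {k : ℕ} (p : Fin k × Fin k) (b : Bool) : (some p, b) ∈ (hubs k)ᶜ := by
  simp [hubs]

lemma ncard_hubs (k : ℕ) : (hubs k).ncard = 2 :=
  Set.ncard_pair (by simp)

lemma colorable_two (k : ℕ) [NeZero k] : (brokenBicliques k).Colorable 2 := by
  simpa using (Coloring.mk Prod.snd fun h => h.1 :
    (brokenBicliques k).Coloring Bool).colorable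

/-- An enumeration of the neighbors of a vertex on the opposite side. -/
def neighbor {k : ℕ} [NeZero k] (u : Option (Fin k × Fin k)) (j : Fin k) :
    Option (Fin k × Fin k) :=
  match u with
  | none => some (j, 0)
  | some p => if p.2 = 0 ∧ j = 0 then none else some (p.1, j)

lemma neighbor_injective {k : ℕ} [NeZero k] (u : Option (Fin k × Fin k)) :
    Function.Injective (neighbor u) := by
  intro i j h
  cases u <;> grind [neighbor]

lemma neighborSet_eq {k : ℕ} [NeZero k] (u : Option (Fin k × Fin k)) (b : Bool) :
    (brokenBicliques k).neighborSet (u, b) = Set.range fun j => (neighbor u j, !b) := by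
  ext ⟨v, c⟩
  simp only [mem_neighborSet, Set.mem_range, Prod.mk.injEq]
  have hbc : b ≠ c ↔ (!b) = c := by cases b <;> cases c <;> simp
  rcases u with _ | ⟨i, j⟩ <;> rcases v with _ | ⟨i', j'⟩ <;>
    simp only [brokenBicliques, neighbor, hbc]
  · simp
  · simp only [Option.some.injEq, Prod.mk.injEq]
    grind
  · constructor
    · rintro ⟨h, h0⟩
      exact ⟨0, if_pos ⟨h0, rfl⟩, h⟩
    · grind
  · constructor
    · rintro ⟨h, rfl, h0⟩
      exact ⟨j', if_neg h0, h⟩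
    · grind

lemma ncard_neighborSet {k : ℕ} [NeZero k] (x : Option (Fin k × Fin k) × Bool) :
    ((brokenBicliques k).neighborSet x).ncard = k := by
  obtain ⟨u, b⟩ := x
  rw [neighborSet_eq, ← Set.image_univ, Set.ncard_image_of_injective, Set.ncard_univ, Nat.card_fin]
  exact fun i j h => neighbor_injective u (Prod.ext_iff.1 h).1

lemma reachable_induce_compl_hubs {k : ℕ} [NeZero k] {j₁ : Fin k} (hj₁ : j₁ ≠ 0) (i j : Fin k)
    (b : Bool) :
    ((brokenBicliques k).induce (hubs k)ᶜ).Reachable ⟨(some (i, j), b), notMem_hubs _ _⟩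
      ⟨(some (i, j₁), true), notMem_hubs _ _⟩ := by
  have adj (j : Fin k) {b c : Bool} (h : b ≠ c) :
      ((brokenBicliques k).induce (hubs k)ᶜ).Adj ⟨(some (i, j), b), notMem_hubs _ _⟩
        ⟨(some (i, j₁), c), notMem_hubs _ _⟩ :=
    ⟨h, rfl, fun h0 => hj₁ h0.2⟩
  cases b
  · exact (adj j (by simp)).reachable
  · exact (adj j (c := false) (by simp)).reachable.trans (adj j₁ (by simp)).reachable

lemma connected {k : ℕ} [NeZero k] {j₁ : Fin k} (hj₁ : j₁ ≠ 0) :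
    (brokenBicliques k).Connected := by
  have copy (i j : Fin k) (b : Bool) :
      (brokenBicliques k).Reachable (some (i, j), b) (some (i, j₁), true) :=
    (reachable_induce_compl_hubs hj₁ i j b).map (Embedding.induce _).toHom
  have hub (i : Fin k) {b c : Bool} (h : b ≠ c) :
      (brokenBicliques k).Reachable (some (i, 0), b) (none, c) :=
    Adj.reachable ⟨h, rfl⟩
  have inner (i j : Fin k) (b : Bool) :
      (brokenBicliques k).Reachable (some (i, j), b) (none, true) :=
    (copy i j b).trans ((copy i 0 false).symm.trans (hub i (by simp)))
  refine connected_iff_exists_forall_reachable _ |>.2 ⟨(none, true), ?_⟩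
  rintro ⟨_ | ⟨i, j⟩, b⟩
  · cases b
    · exact (inner 0 0 true).symm.trans (hub 0 (by simp))
    · rfl
  · exact (inner i j b).symm

end brokenBicliques

/-- If the fibers of a surjection `p` are exactly the reachability classes of `G`, then the
number of components of `G` is the cardinality of the codomain. -/
lemma SimpleGraph.natCard_connectedComponent_of_surjective {V ι : Type*} {G : SimpleGraph V}
    (p : V → ι) (hp : Function.Surjective p) (hadj : ∀ u v, G.Adj u v → p u = p v)
    (hreach : ∀ u v, p u = p v → G.Reachable u v) :
    Nat.card G.ConnectedComponent = Nat.card ι := by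
  have const {u v : V} (w : G.Walk u v) : p u = p v := by
    induction w with
    | nil => rfl
    | cons h _ ih => exact (hadj _ _ h).trans ih
  refine Nat.card_congr (Equiv.ofBijective
    (ConnectedComponent.lift p fun _ _ w _ => const w) ⟨?_, fun i => ?_⟩)
  · refine ConnectedComponent.ind₂ fun u v h => ?_
    exact ConnectedComponent.sound (hreach u v h)
  · obtain ⟨v, rfl⟩ := hp i
    exact ⟨G.connectedComponentMk v, rfl⟩

lemma brokenBicliques.numComp_hubs {k : ℕ} [NeZero k] {j₁ : Fin k} (hj₁ : j₁ ≠ 0) :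
    numComp (brokenBicliques k) (hubs k) = k := by
  let p (x : ((hubs k)ᶜ : Set _)) : Fin k := (x.1.1.getD (0, 0)).1
  rw [numComp, natCard_connectedComponent_of_surjective p, Nat.card_fin]
  · exact fun i => ⟨⟨(some (i, 0), true), notMem_hubs _ _⟩, rfl⟩
  · rintro ⟨⟨_ | q, b⟩, hx⟩ ⟨⟨_ | r, c⟩, hy⟩ h
    · exact h.2.elim
    · cases b <;> simp [hubs] at hx
    · cases c <;> simp [hubs] at hy
    · exact h.2.1
  · rintro ⟨⟨_ | ⟨i, j⟩, b⟩, hx⟩ ⟨⟨_ | ⟨i', j'⟩, c⟩, hy⟩ h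
    · cases b <;> simp [hubs] at hx
    · cases b <;> simp [hubs] at hx
    · cases c <;> simp [hubs] at hy
    · obtain rfl : i = i' := h
      exact (reachable_induce_compl_hubs hj₁ i j b).trans
        (reachable_induce_compl_hubs hj₁ i j' c).symm

lemma numComp_image_iso {V W : Type} {G : SimpleGraph V} {H : SimpleGraph W} (φ : G ≃g H)
    (S : Set V) : numComp H (φ '' S) = numComp G S := by
  have e : G.induce Sᶜ ≃g H.induce (φ '' S)ᶜ :=
    { toEquiv := (φ.toEquiv.image Sᶜ).trans
        (Equiv.setCongr (Set.image_compl_eq φ.toEquiv.bijective))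
      map_rel_iff' := φ.map_rel_iff }
  exact (Nat.card_congr e.connectedComponentEquiv).symm

/-- For every `k ≥ 2` there is a connected bipartite `k`-regular graph `G` with a
disconnecting set `S` of size `2` such that `G − S` has `k` components; in particular
`t(G) ≤ 2/k`. -/
theorem exists_bipartite_regular_small_toughness (k : ℕ) (hk : 2 ≤ k) :
    ∃ (n : ℕ) (G : SimpleGraph (Fin n)),
      G.Connected ∧ G.Colorable 2 ∧ (∀ v, (G.neighborSet v).ncard = k) ∧
      ∃ S : Set (Fin n), S.ncard = 2 ∧ 2 ≤ numComp G S ∧ numComp G S = k := by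
  have : NeZero k := ⟨by omega⟩
  have hj₁ : (⟨1, hk⟩ : Fin k) ≠ 0 := by simp [Fin.ext_iff]
  let e := Fintype.equivFin (Option (Fin k × Fin k) × Bool)
  let φ := Iso.map e (brokenBicliques k)
  have hcomp := (numComp_image_iso φ _).trans (brokenBicliques.numComp_hubs hj₁)
  refine ⟨_, _, φ.connected_iff.1 (brokenBicliques.connected hj₁),
    (brokenBicliques.colorable_two k).of_hom φ.symm.toHom, fun v => ?_,
    φ '' brokenBicliques.hubs k, ?_, hk.trans_eq hcomp.symm, hcomp⟩
  · exact (Nat.card_congr (φ.symm.mapNeighborSet v)).trans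
      (brokenBicliques.ncard_neighborSet (φ.symm v))
  · rw [Set.ncard_image_of_injective _ φ.injective, brokenBicliques.ncard_hubs]
end

section
/- For every even integer k ≥ 4 there exists a connected k-regular finite simple graph G on k² + k − 3 vertices with λ_2(G) = (k − 2 + √(k² + 12))/2 that admits a disconnecting set S of size k − 2 with c(G − S) = k − 1; in particular t(G) ≤ (k−2)/(k−1) < 1. -/
open SimpleGraph Matrix

section Spectrum

variable {V W : Type} [Fintype V] [DecidableEq V] [Fintype W] [DecidableEq W]

open Classical in
lemma adjEigs_eq_roots (G : SimpleGraph V) :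
    adjEigs G = ((G.adjMatrix ℝ).charpoly.roots.sort (· ≤ ·)).reverse := by
  have hA : (G.adjMatrix ℝ).IsHermitian := by
    rw [Matrix.IsHermitian, Matrix.conjTranspose_eq_transpose_of_trivial]
    exact G.isSymm_adjMatrix
  rw [hA.roots_charpoly_eq_eigenvalues]
  unfold adjEigs
  congr!

lemma adjEig_congr {G : SimpleGraph V} {H : SimpleGraph W} (e : G ≃g H) (i : ℕ) :
    adjEig G i = adjEig H i := by
  classical
  have h : G.adjMatrix ℝ = Matrix.reindex e.toEquiv.symm e.toEquiv.symm (H.adjMatrix ℝ) := by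
    ext u v
    simp [SimpleGraph.adjMatrix_apply, e.map_adj_iff]
  rw [adjEig, adjEig, adjEigs_eq_roots, adjEigs_eq_roots]
  have h2 := Matrix.charpoly_reindex e.toEquiv.symm (H.adjMatrix ℝ)
  rw [← h] at h2
  rw [← h2]

lemma sort_reverse_getD_one {κ θ : ℝ} (M : Multiset ℝ) (h : θ ≤ κ) (hM : ∀ x ∈ M, x ≤ θ) :
    ((κ ::ₘ θ ::ₘ M).sort (· ≤ ·)).reverse.getD 1 0 = θ := by
  have : (κ ::ₘ θ ::ₘ M).sort (· ≤ ·) = M.sort (· ≤ ·) ++ [θ, κ] := by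
    apply List.Perm.eq_of_pairwise (le := (· ≤ ·)) (fun _ _ _ _ => le_antisymm)
      (Multiset.pairwise_sort _ _)
    · rw [List.pairwise_append]
      refine ⟨Multiset.pairwise_sort _ _, by simpa using h, ?_⟩
      intro a ha b hb
      have := hM a (by simpa using ha)
      simp only [List.mem_cons, List.not_mem_nil, or_false] at hb
      rcases hb with rfl | rfl <;> linarith
    · rw [← Multiset.coe_eq_coe, Multiset.sort_eq, ← Multiset.coe_add, Multiset.sort_eq]
      change _ = M + ({θ} + {κ})
      rw [← Multiset.singleton_add, ← Multiset.singleton_add]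
      abel
  simp [this]

open Classical in
/-- If `κ > θ` is an eigenvalue of `G` with a constant eigenvector, `θ` is an eigenvalue, and
every eigenvector for an eigenvalue above `θ` is constant, then `θ` is the second largest
eigenvalue of `G`. -/
lemma adjEig_two_eq (G : SimpleGraph V) [Nonempty V] {κ θ : ℝ} (hθκ : θ < κ)
    (hκ : G.adjMatrix ℝ *ᵥ (fun _ => 1) = κ • (fun _ => 1))
    (hθ : ∃ y : V → ℝ, y ≠ 0 ∧ G.adjMatrix ℝ *ᵥ y = θ • y)
    (hconst : ∀ μ > θ, ∀ x : V → ℝ, G.adjMatrix ℝ *ᵥ x = μ • x → ∃ c, x = fun _ => c) :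
    adjEig G 2 = θ := by
  have hA : (G.adjMatrix ℝ).IsHermitian := by
    rw [Matrix.IsHermitian, Matrix.conjTranspose_eq_transpose_of_trivial]
    exact G.isSymm_adjMatrix
  have exists_index : ∀ (μ : ℝ) (y : V → ℝ), y ≠ 0 → G.adjMatrix ℝ *ᵥ y = μ • y →
      ∃ i, hA.eigenvalues i = μ := by
    intro μ y hy h
    have h1 : Module.End.HasEigenvalue (Matrix.toLin' (G.adjMatrix ℝ)) μ :=
      Module.End.hasEigenvalue_of_hasEigenvector
        (x := y) ⟨Module.End.mem_eigenspace_iff.2 (by simpa using h), hy⟩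
    have h2 := h1.mem_spectrum
    rw [Matrix.spectrum_toLin', hA.spectrum_real_eq_range_eigenvalues] at h2
    exact h2
  obtain ⟨i, hi⟩ := exists_index κ _ (by
    intro h
    have := congrFun h (Classical.arbitrary V)
    simp at this) hκ
  obtain ⟨y, hy0, hy⟩ := hθ
  obtain ⟨j, hj⟩ := exists_index θ y hy0 hy
  have hij : j ≠ i := by
    rintro rfl
    linarith
  have const_of_gt : ∀ l, θ < hA.eigenvalues l →
      ∃ c : ℝ, c ≠ 0 ∧ ∀ v, hA.eigenvectorBasis l v = c := by
    intro l hl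
    obtain ⟨c, hc⟩ := hconst _ hl _ (hA.mulVec_eigenvectorBasis l)
    refine ⟨c, ?_, fun v => congrFun hc v⟩
    rintro rfl
    have h0 : hA.eigenvectorBasis l = 0 := by
      ext v
      exact congrFun hc v
    have := hA.eigenvectorBasis.orthonormal.1 l
    simp [h0] at this
  have le_of_ne : ∀ l, l ≠ i → hA.eigenvalues l ≤ θ := by
    intro l hl
    by_contra! hlt
    obtain ⟨c, hc0, hc⟩ := const_of_gt l hlt
    obtain ⟨d, hd0, hd⟩ := const_of_gt i (by rw [hi]; exact hθκ)
    have : inner ℝ (hA.eigenvectorBasis l) (hA.eigenvectorBasis i) = 0 :=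
      hA.eigenvectorBasis.orthonormal.2 hl
    rw [PiLp.inner_apply] at this
    simp [hc, hd, hc0, hd0] at this
  have huniv : (Finset.univ : Finset V).val.map hA.eigenvalues =
      κ ::ₘ θ ::ₘ (((Finset.univ.erase i).erase j).val.map hA.eigenvalues) := by
    rw [← hi, ← hj, ← Multiset.map_cons, ← Multiset.map_cons]
    congr 1
    rw [← Finset.insert_val_of_notMem (Finset.notMem_erase j _),
      Finset.insert_erase (by simp [hij]),
      ← Finset.insert_val_of_notMem (Finset.notMem_erase i _),
      Finset.insert_erase (Finset.mem_univ i)]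
  rw [adjEig, adjEigs_eq_roots, hA.roots_charpoly_eq_eigenvalues]
  change ((Finset.univ.val.map hA.eigenvalues).sort (· ≤ ·)).reverse.getD 1 0 = θ
  rw [huniv]
  refine sort_reverse_getD_one _ hθκ.le ?_
  intro x hx
  obtain ⟨l, hl, rfl⟩ := Multiset.mem_map.1 hx
  refine le_of_ne l ?_
  rintro rfl
  have := Finset.mem_of_mem_erase (Finset.mem_def.2 hl)
  exact Finset.notMem_erase _ _ this

end Spectrum

/-- If the vertices outside `S` are labelled by `C` so that labels are constant along edges of
`G − S`, and each label class is nonempty with a vertex dominating it, then `G − S` has exactly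
one component per label. -/
lemma numComp_eq_card {V C : Type} (G : SimpleGraph V) (S : Set V) (f : V → C) (r : C → V)
    (hf : ∀ u v, u ∉ S → v ∉ S → G.Adj u v → f u = f v) (hrS : ∀ c, r c ∉ S)
    (hfr : ∀ c, f (r c) = c) (hr : ∀ v, v ∉ S → v = r (f v) ∨ G.Adj v (r (f v))) :
    numComp G S = Nat.card C := by
  symm
  apply Nat.card_eq_of_bijective
    (fun c => (G.induce Sᶜ).connectedComponentMk ⟨r c, hrS c⟩)
  constructor
  · intro c d hcd
    obtain ⟨p⟩ := SimpleGraph.ConnectedComponent.exact hcd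
    have key : ∀ (u v : (Sᶜ : Set V)), (G.induce Sᶜ).Walk u v → f u = f v := by
      intro u v p
      induction p with
      | nil => rfl
      | @cons u v _ h _ ih => exact (hf u v u.2 v.2 h).trans ih
    simpa [hfr] using key _ _ p
  · intro K
    induction K using SimpleGraph.ConnectedComponent.ind with
    | h v =>
      refine ⟨f v, ?_⟩
      apply SimpleGraph.ConnectedComponent.sound
      rcases hr v v.2 with h | h
      · have : (⟨r (f v), hrS _⟩ : (Sᶜ : Set V)) = v := Subtype.ext h.symm
        rw [this]
      · exact (SimpleGraph.Adj.reachable (G := G.induce Sᶜ) (u := v)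
          (v := ⟨r (f v), hrS _⟩) h).symm

section Construction

variable {ι C : Type}

/-- The adjacency relation of `toughGraph`. -/
def toughAdj (σ : ι → ι) : ι ⊕ C × (Fin 3 ⊕ ι) → ι ⊕ C × (Fin 3 ⊕ ι) → Prop
  | .inl s, .inl t => t = σ s
  | .inl _, .inr (_, .inl _) => False
  | .inl s, .inr (_, .inr t) => s = t
  | .inr (_, .inl _), .inl _ => False
  | .inr (_, .inr s), .inl t => s = t
  | .inr (c, .inl i), .inr (d, .inl j) => c = d ∧ i ≠ j
  | .inr (c, .inl _), .inr (d, .inr _) => c = d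
  | .inr (c, .inr _), .inr (d, .inl _) => c = d
  | .inr (c, .inr s), .inr (d, .inr t) => c = d ∧ s ≠ t ∧ t ≠ σ s

/-- Let `σ` be a fixed-point-free involution of `ι`. The vertices `inl s` are matched by `σ`;
for each `c : C` the vertices `inr (c, _)` form a complete graph with the matching
`inr (c, inr s) — inr (c, inr (σ s))` removed; and `inl s` is joined to each `inr (c, inr s)`. -/
def toughGraph (C : Type) (σ : ι → ι) (hσ : ∀ s, σ (σ s) = s) (hne : ∀ s, σ s ≠ s) :
    SimpleGraph (ι ⊕ C × (Fin 3 ⊕ ι)) where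
  Adj := toughAdj σ
  symm := ⟨by
    rintro (s | ⟨c, i | s⟩) (t | ⟨d, j | t⟩) h <;> simp only [toughAdj] at h ⊢ <;> grind⟩
  loopless := ⟨by
    rintro (s | ⟨c, i | s⟩) h <;> simp only [toughAdj] at h <;> grind⟩

variable (σ : ι → ι) (hσ : ∀ s, σ (σ s) = s) (hne : ∀ s, σ s ≠ s)

lemma toughGraph_adj (u v : ι ⊕ C × (Fin 3 ⊕ ι)) :
    (toughGraph C σ hσ hne).Adj u v ↔ toughAdj σ u v := Iff.rfl

lemma toughGraph_connected [Nonempty ι] [Nonempty C] :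
    (toughGraph C σ hσ hne).Connected := by
  let G := toughGraph C σ hσ hne
  have hub : ∀ (c : C) (s : ι), G.Reachable (.inr (c, .inr s)) (.inr (c, .inl 0)) :=
    fun c s => SimpleGraph.Adj.reachable (G := G)
      (show toughAdj σ (.inr (c, .inr s)) (.inr (c, .inl 0)) from rfl)
  have spoke : ∀ (c : C) (s : ι), G.Reachable (.inl s) (.inr (c, .inr s)) :=
    fun c s => SimpleGraph.Adj.reachable (G := G)
      (show toughAdj σ (.inl s) (.inr (c, .inr s)) from rfl)
  obtain ⟨s₀⟩ := ‹Nonempty ι›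
  obtain ⟨c₀⟩ := ‹Nonempty C›
  have hubs : ∀ c : C, G.Reachable (.inr (c, .inl 0)) (.inr (c₀, .inl 0)) := fun c =>
    (hub c s₀).symm.trans ((spoke c s₀).symm.trans ((spoke c₀ s₀).trans (hub c₀ s₀)))
  have all : ∀ v, G.Reachable v (.inr (c₀, .inl 0)) := by
    rintro (s | ⟨c, i | s⟩)
    · exact (spoke c₀ s).trans (hub c₀ s)
    · by_cases hi : i = 0
      · rw [hi]
        exact hubs c
      · have hadj : G.Adj (.inr (c, .inl i)) (.inr (c, .inl 0)) :=
          show toughAdj σ (.inr (c, .inl i)) (.inr (c, .inl 0)) from ⟨rfl, hi⟩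
        exact hadj.reachable.trans (hubs c)
    · exact (hub c s).trans (hubs c)
  have : Nonempty (ι ⊕ C × (Fin 3 ⊕ ι)) := ⟨.inl s₀⟩
  exact SimpleGraph.Connected.mk fun u v => (all u).trans (all v).symm

variable [Fintype ι] [Fintype C]

section Action

variable [DecidableRel (toughGraph C σ hσ hne).Adj] (x : ι ⊕ C × (Fin 3 ⊕ ι) → ℝ)

lemma toughGraph_mulVec_inl (s : ι) :
    ((toughGraph C σ hσ hne).adjMatrix ℝ *ᵥ x) (.inl s) =
      x (.inl (σ s)) + ∑ c, x (.inr (c, .inr s)) := by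
  classical
  simp only [Matrix.mulVec, dotProduct, SimpleGraph.adjMatrix_apply, toughGraph_adj, toughAdj,
    Fintype.sum_sum_type, Fintype.sum_prod_type, ite_mul, one_mul, zero_mul]
  simp

lemma toughGraph_mulVec_inr_inl (c : C) (i : Fin 3) :
    ((toughGraph C σ hσ hne).adjMatrix ℝ *ᵥ x) (.inr (c, .inl i)) =
      ∑ j, x (.inr (c, .inl j)) - x (.inr (c, .inl i)) + ∑ t, x (.inr (c, .inr t)) := by
  classical
  simp only [Matrix.mulVec, dotProduct, SimpleGraph.adjMatrix_apply, toughGraph_adj, toughAdj,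
    Fintype.sum_sum_type, Fintype.sum_prod_type, ite_mul, one_mul, zero_mul]
  have h : ∀ (j : Fin 3) [Decidable (i ≠ j)], (if i ≠ j then x (.inr (c, .inl j)) else 0) =
      x (.inr (c, .inl j)) - if i = j then x (.inr (c, .inl j)) else 0 := by
    intro j _
    by_cases hij : i = j <;> simp [hij]
  rw [Fintype.sum_eq_single c fun d hd => by simp [hd.symm]]
  simp only [true_and, if_true, if_false, h, Finset.sum_sub_distrib, Finset.sum_ite_eq,
    Finset.mem_univ, Finset.sum_const_zero, zero_add]

lemma toughGraph_mulVec_inr_inr (c : C) (s : ι) :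
    ((toughGraph C σ hσ hne).adjMatrix ℝ *ᵥ x) (.inr (c, .inr s)) =
      ∑ j, x (.inr (c, .inl j)) + ∑ t, x (.inr (c, .inr t)) - x (.inr (c, .inr s))
        - x (.inr (c, .inr (σ s))) + x (.inl s) := by
  classical
  simp only [Matrix.mulVec, dotProduct, SimpleGraph.adjMatrix_apply, toughGraph_adj, toughAdj,
    Fintype.sum_sum_type, Fintype.sum_prod_type, ite_mul, one_mul, zero_mul]
  have h : ∀ (t : ι) [Decidable (s ≠ t ∧ t ≠ σ s)],
      (if s ≠ t ∧ t ≠ σ s then x (.inr (c, .inr t)) else 0) =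
      x (.inr (c, .inr t)) - (if s = t then x (.inr (c, .inr t)) else 0)
        - if t = σ s then x (.inr (c, .inr t)) else 0 := by
    intro t _
    have hs := hne s
    by_cases h1 : s = t
    · subst h1
      simp [hs.symm]
    · by_cases h2 : t = σ s <;> simp [h1, h2, hs.symm]
  rw [Fintype.sum_eq_single c fun d hd => by simp [hd.symm]]
  simp only [true_and, if_true, h, Finset.sum_sub_distrib, Finset.sum_ite_eq,
    Finset.sum_ite_eq', Finset.mem_univ]
  ring

lemma toughGraph_mulVec_one (hC : Fintype.card C = Fintype.card ι + 1) :
    (toughGraph C σ hσ hne).adjMatrix ℝ *ᵥ (fun _ => 1) =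
      ((Fintype.card ι : ℝ) + 2) • (fun _ => 1) := by
  funext v
  rcases v with s | ⟨c, i | s⟩
  · rw [toughGraph_mulVec_inl]
    simp [hC]
    ring
  · rw [toughGraph_mulVec_inr_inl]
    simp
    ring
  · rw [toughGraph_mulVec_inr_inr]
    simp
    ring

lemma toughGraph_mulVec_eq_smul {θ : ℝ}
    (hθ : θ ^ 2 - Fintype.card ι * θ - (Fintype.card ι + 4) = 0)
    (w : C → ℝ) (hw : ∑ c, w c = 0) :
    (toughGraph C σ hσ hne).adjMatrix ℝ *ᵥ
        Sum.elim (fun _ => 0) (fun p => w p.1 * p.2.elim (fun _ => (Fintype.card ι : ℝ)) fun _ => θ - 2) =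
      θ • Sum.elim (fun _ => 0)
        (fun p => w p.1 * p.2.elim (fun _ => (Fintype.card ι : ℝ)) fun _ => θ - 2) := by
  funext v
  rcases v with s | ⟨c, i | s⟩
  · rw [toughGraph_mulVec_inl]
    simp [← Finset.sum_mul, hw]
  · rw [toughGraph_mulVec_inr_inl]
    simp
    ring
  · rw [toughGraph_mulVec_inr_inr]
    simp
    linear_combination (-w c) * hθ

end Action

lemma toughGraph_ncard_neighborSet (hC : Fintype.card C = Fintype.card ι + 1)
    (v : ι ⊕ C × (Fin 3 ⊕ ι)) :
    ((toughGraph C σ hσ hne).neighborSet v).ncard = Fintype.card ι + 2 := by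
  classical
  have h := congrFun (toughGraph_mulVec_one σ hσ hne hC) v
  rw [SimpleGraph.adjMatrix_mulVec_apply] at h
  simp only [Finset.sum_const, nsmul_eq_mul, mul_one, Pi.smul_apply, smul_eq_mul,
    SimpleGraph.card_neighborFinset_eq_degree] at h
  rw [Set.ncard_eq_toFinset_card', Set.toFinset_card, SimpleGraph.card_neighborSet_eq_degree]
  exact_mod_cast h

/-- Eigenvectors of `toughGraph` for large eigenvalues are constant. -/
lemma toughGraph_eigenvector_const [Nonempty ι] [Nonempty C]
    [DecidableRel (toughGraph C σ hσ hne).Adj]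
    (hC : Fintype.card C = Fintype.card ι + 1) {μ : ℝ} (hμ2 : 2 < μ)
    (hμι : (Fintype.card ι : ℝ) + 1 < μ)
    (hμ : 0 < μ ^ 2 - Fintype.card ι * μ - (Fintype.card ι + 4))
    (x : ι ⊕ C × (Fin 3 ⊕ ι) → ℝ)
    (hx : (toughGraph C σ hσ hne).adjMatrix ℝ *ᵥ x = μ • x) :
    ∃ c, x = fun _ => c := by
  have eq_zero : ∀ {p q : ℝ}, 0 < p → p * q = 0 → q = 0 := fun hp h =>
    (mul_eq_zero.1 h).resolve_left hp.ne'
  set n : ℝ := (Fintype.card ι : ℝ) with hn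
  have hn0 : 0 ≤ n := Nat.cast_nonneg _
  have h1 : ∀ s, x (.inl (σ s)) + ∑ c, x (.inr (c, .inr s)) = μ * x (.inl s) := fun s => by
    rw [← toughGraph_mulVec_inl σ hσ hne, hx]
    rfl
  have h2 : ∀ c i, ∑ j, x (.inr (c, .inl j)) - x (.inr (c, .inl i))
      + ∑ t, x (.inr (c, .inr t)) = μ * x (.inr (c, .inl i)) := fun c i => by
    rw [← toughGraph_mulVec_inr_inl σ hσ hne, hx]
    rfl
  have h3 : ∀ c s, ∑ j, x (.inr (c, .inl j)) + ∑ t, x (.inr (c, .inr t)) - x (.inr (c, .inr s))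
      - x (.inr (c, .inr (σ s))) + x (.inl s) = μ * x (.inr (c, .inr s)) := fun c s => by
    rw [← toughGraph_mulVec_inr_inr σ hσ hne, hx]
    rfl
  clear hx
  set A : C → ℝ := fun c => ∑ j, x (.inr (c, .inl j)) with hA
  set B : C → ℝ := fun c => ∑ t, x (.inr (c, .inr t)) with hB
  have h2' : ∀ c i, A c - x (.inr (c, .inl i)) + B c = μ * x (.inr (c, .inl i)) := h2
  have h3' : ∀ c s, A c + B c - x (.inr (c, .inr s))
      - x (.inr (c, .inr (σ s))) + x (.inl s) = μ * x (.inr (c, .inr s)) := h3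
  have sumA : ∀ c, 2 * A c + 3 * B c = μ * A c := by
    intro c
    have := Finset.sum_congr (rfl : (Finset.univ : Finset (Fin 3)) = _) fun i _ => h2' c i
    rw [← Finset.mul_sum, Finset.sum_add_distrib, Finset.sum_sub_distrib] at this
    simp only [Finset.sum_const, Finset.card_univ, Fintype.card_fin, nsmul_eq_mul] at this
    change _ - A c + _ = μ * A c at this
    push_cast at this
    linarith
  have sumB : ∀ c, n * A c + n * B c - 2 * B c + ∑ s, x (.inl s) = μ * B c := by
    intro c
    have hs : ∑ s, x (.inr (c, .inr (σ s))) = B c :=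
      Equiv.sum_comp (⟨σ, σ, hσ, hσ⟩ : Equiv.Perm ι) fun s => x (.inr (c, .inr s))
    have := Finset.sum_congr (rfl : (Finset.univ : Finset ι) = _) fun s _ => h3' c s
    rw [← Finset.mul_sum, Finset.sum_add_distrib, Finset.sum_sub_distrib,
      Finset.sum_sub_distrib, hs] at this
    simp only [Finset.sum_const, Finset.card_univ, nsmul_eq_mul, ← hn] at this
    change _ - B c - _ + _ = μ * B c at this
    linarith
  obtain ⟨c₀⟩ := ‹Nonempty C›
  obtain ⟨s₀⟩ := ‹Nonempty ι›
  have hAc : ∀ c, A c = A c₀ := by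
    intro c
    have hz : A c - A c₀ = 0 := eq_zero hμ (by
      linear_combination (-(μ - n + 2)) * (sumA c - sumA c₀) - 3 * (sumB c - sumB c₀))
    linarith
  have hBc : ∀ c, B c = B c₀ := by
    intro c
    have := sumA c
    have := sumA c₀
    rw [hAc c] at *
    linarith
  have hbc : ∀ c s, x (.inr (c, .inr s)) = x (.inr (c₀, .inr s)) := by
    intro c s
    have e1 := h3' c s
    have e2 := h3' c₀ s
    have e3 := h3' c (σ s)
    have e4 := h3' c₀ (σ s)
    rw [hσ] at e3 e4
    rw [hAc, hBc] at e1 e3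
    have hsum := eq_zero (p := μ + 2) (by linarith)
      (q := x (.inr (c, .inr s)) + x (.inr (c, .inr (σ s))) -
        (x (.inr (c₀, .inr s)) + x (.inr (c₀, .inr (σ s)))))
      (by linear_combination e2 - e1 + e4 - e3)
    have := eq_zero (p := μ) (by linarith)
      (q := x (.inr (c, .inr s)) - x (.inr (c₀, .inr s)))
      (by linear_combination e2 - e1 - hsum)
    linarith
  have h1' : ∀ s, x (.inl (σ s)) + (n + 1) * x (.inr (c₀, .inr s)) = μ * x (.inl s) := by
    intro s
    rw [← h1 s]
    simp only [hbc, Finset.sum_const, Finset.card_univ, nsmul_eq_mul, hC]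
    push_cast
    ring
  have hlarge : 0 < μ * (μ + 1) - (n + 1) := by nlinarith
  have hswap : ∀ s, x (.inr (c₀, .inr (σ s))) = x (.inr (c₀, .inr s)) ∧
      x (.inl (σ s)) = x (.inl s) := by
    intro s
    have e1 := h1' s
    have e2 := h1' (σ s)
    have e3 := h3' c₀ s
    have e4 := h3' c₀ (σ s)
    rw [hσ] at e2 e4
    have hb := eq_zero hlarge (q := x (.inr (c₀, .inr (σ s))) - x (.inr (c₀, .inr s)))
      (by linear_combination (μ + 1) * (e3 - e4) + e1 - e2)
    refine ⟨by linarith, ?_⟩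
    linear_combination e4 - e3 + μ * hb
  have hbs : ∀ s, x (.inr (c₀, .inr s)) = x (.inr (c₀, .inr s₀)) := by
    intro s
    have e1 := h1' s
    have e2 := h1' s₀
    have e3 := h3' c₀ s
    have e4 := h3' c₀ s₀
    rw [(hswap _).2] at e1 e2
    rw [(hswap _).1] at e3 e4
    have := eq_zero (p := (μ - 1) * (μ + 2) - (n + 1)) (by nlinarith)
      (q := x (.inr (c₀, .inr s)) - x (.inr (c₀, .inr s₀)))
      (by linear_combination (μ - 1) * (e4 - e3) + e2 - e1)
    linarith
  have hxs : ∀ s, (μ - 1) * x (.inl s) = (n + 1) * x (.inr (c₀, .inr s₀)) := by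
    intro s
    have e1 := h1' s
    rw [(hswap _).2, hbs] at e1
    linarith
  have hBn : B c₀ = n * x (.inr (c₀, .inr s₀)) := by
    simp only [hB, hbs, Finset.sum_const, Finset.card_univ, nsmul_eq_mul, ← hn]
  set b := x (.inr (c₀, .inr s₀)) with hb
  have e3 := h3' c₀ s₀
  rw [(hswap _).1, ← hb, hBn] at e3
  have hsA := sumA c₀
  rw [hBn] at hsA
  have hp : μ * (x (.inl s₀) - b) = -(A c₀ - 3 * b) := by
    linear_combination hxs s₀ + e3
  have hq : (μ + 1) * (A c₀ - 3 * b) = -3 * (x (.inl s₀) - b) := by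
    linear_combination 3 * e3 - hsA
  have hA3 : A c₀ - 3 * b = 0 := eq_zero (p := μ * (μ + 1) - 3) (by nlinarith) (by
    linear_combination μ * hq - 3 * hp)
  have hbn : (n + 2 - μ) * b = 0 := by
    linear_combination (hsA + (μ - 2) * hA3) / 3
  refine ⟨b, ?_⟩
  funext v
  rcases v with s | ⟨c, i | s⟩
  · have := eq_zero (p := μ - 1) (q := x (.inl s) - b) (by linarith) (by
      linear_combination hxs s + hbn)
    linarith
  · have e2 := h2' c i
    rw [hAc, hBc, hBn] at e2
    have := eq_zero (p := μ + 1) (q := x (.inr (c, .inl i)) - b) (by linarith) (by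
      linear_combination hA3 + hbn - e2)
    linarith
  · rw [hbc, hbs]

lemma toughGraph_adjEig_two [DecidableEq ι] [DecidableEq C]
    (hC : Fintype.card C = Fintype.card ι + 1) (hι : 2 ≤ Fintype.card ι) :
    adjEig (toughGraph C σ hσ hne) 2 =
      ((Fintype.card ι : ℝ) + Real.sqrt (((Fintype.card ι : ℝ) + 2) ^ 2 + 12)) / 2 := by
  classical
  have : Nonempty ι := Fintype.card_pos_iff.1 (by omega)
  have : Nontrivial C := Fintype.one_lt_card_iff_nontrivial.1 (by omega)
  have hn : (2 : ℝ) ≤ Fintype.card ι := by exact_mod_cast hι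
  set n : ℝ := (Fintype.card ι : ℝ) with hn_def
  set q := Real.sqrt ((n + 2) ^ 2 + 12) with hq_def
  have hq2 : q ^ 2 = (n + 2) ^ 2 + 12 := Real.sq_sqrt (by positivity)
  have hq0 : 0 ≤ q := Real.sqrt_nonneg _
  have hq_lower : n + 2 < q := by nlinarith
  have hq_upper : q < n + 4 := by nlinarith
  have hroot : ((n + q) / 2) ^ 2 - n * ((n + q) / 2) - (n + 4) = 0 := by
    linear_combination hq2 / 4
  refine adjEig_two_eq _ (κ := n + 2) (by linarith) (toughGraph_mulVec_one σ hσ hne hC) ?_ ?_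
  · obtain ⟨c, d, hcd⟩ := exists_pair_ne C
    refine ⟨_, ?_, toughGraph_mulVec_eq_smul σ hσ hne hroot
      (Pi.single c 1 - Pi.single d 1) (by simp)⟩
    intro h
    have := congrFun h (.inr (c, .inl 0))
    simp [Pi.single_eq_of_ne hcd] at this
  · intro μ hμ x hx
    refine toughGraph_eigenvector_const σ hσ hne hC (by linarith) (by rw [← hn_def]; linarith) ?_
      x hx
    rw [← hn_def]
    nlinarith

end Construction

/-- For every even `k ≥ 4` there is a connected `k`-regular graph `G` on `k² + k − 3`
vertices with `λ₂(G) = (k − 2 + √(k² + 12))/2` admitting a disconnecting set `S` of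
size `k − 2` with `c(G − S) = k − 1`; in particular `t(G) ≤ (k − 2)/(k − 1) < 1`. -/
theorem exists_extremal_graph_even (k : ℕ) (hk : 4 ≤ k) (heven : Even k) :
    ∃ G : SimpleGraph (Fin (k ^ 2 + k - 3)),
      G.Connected ∧ (∀ v, (G.neighborSet v).ncard = k) ∧
      adjEig G 2 = ((k : ℝ) - 2 + Real.sqrt ((k : ℝ) ^ 2 + 12)) / 2 ∧
      ∃ S : Set (Fin (k ^ 2 + k - 3)),
        S.ncard = k - 2 ∧ 2 ≤ numComp G S ∧ numComp G S = k - 1 := by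
  obtain ⟨r, rfl⟩ := heven
  obtain ⟨m, rfl⟩ : ∃ m, r = m + 1 := ⟨r - 1, by omega⟩
  let σ : Fin m × Bool → Fin m × Bool := fun p => (p.1, !p.2)
  have hσ : ∀ s, σ (σ s) = s := fun s => by simp [σ]
  have hne : ∀ s, σ s ≠ s := fun s h => by simpa [σ] using congrArg Prod.snd h
  let C := Fin (2 * m + 1)
  have hι : Fintype.card (Fin m × Bool) = 2 * m := by simp [mul_comm]
  have hC : Fintype.card C = Fintype.card (Fin m × Bool) + 1 := by
    rw [hι, Fintype.card_fin]
  let V := (Fin m × Bool) ⊕ C × (Fin 3 ⊕ (Fin m × Bool))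
  have hV : Fintype.card V = (m + 1 + (m + 1)) ^ 2 + (m + 1 + (m + 1)) - 3 := by
    simp only [V, Fintype.card_sum, Fintype.card_prod, hC, hι, Fintype.card_fin]
    symm
    apply Nat.sub_eq_of_eq_add
    ring
  let e := (Fintype.equivFinOfCardEq hV).symm
  let H := toughGraph C σ hσ hne
  let φ : H.comap e ≃g H := SimpleGraph.Iso.comap e H
  have : Nonempty (Fin m × Bool) := Fintype.card_pos_iff.1 (by omega)
  have hcomp : numComp (H.comap e) (e ⁻¹' Set.range Sum.inl) = 2 * m + 1 := by
    rw [numComp_eq_card (C := C) _ _ (fun v => Sum.elim (fun _ => 0) Prod.fst (e v))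
      (fun c => e.symm (.inr (c, .inl 0)))]
    · simp [C]
    · intro u v hu hv huv
      change toughAdj σ (e u) (e v) at huv
      simp only [Set.mem_preimage] at hu hv
      generalize e u = u' at *
      generalize e v = v' at *
      rcases u' with s | ⟨c, i | s⟩ <;> rcases v' with t | ⟨d, j | t⟩ <;>
        simp_all [toughAdj]
    · simp
    · simp
    · intro v hv
      change _ ∨ toughAdj σ (e v) (e (e.symm _))
      rw [Equiv.eq_symm_apply, Equiv.apply_symm_apply]
      simp only [Set.mem_preimage] at hv
      generalize e v = v' at *
      rcases v' with s | ⟨c, i | s⟩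
      · simp at hv
      · by_cases hi : i = 0 <;> simp [toughAdj, hi]
      · simp [toughAdj]
  refine ⟨H.comap e, φ.connected_iff.2 (toughGraph_connected σ hσ hne), ?_, ?_,
    e ⁻¹' Set.range Sum.inl, ?_, by omega, by omega⟩
  · intro v
    have := toughGraph_ncard_neighborSet σ hσ hne hC (e v)
    rw [← Nat.card_coe_set_eq, Nat.card_congr (φ.mapNeighborSet v), Nat.card_coe_set_eq]
    change (H.neighborSet (e v)).ncard = _
    rw [this, hι]
    ring
  · rw [adjEig_congr φ, toughGraph_adjEig_two σ hσ hne hC (by omega), hι]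
    push_cast
    ring_nf
  · rw [Set.ncard_preimage_of_injective_subset_range e.injective (by simp),
      ← Set.image_univ, Set.ncard_image_of_injective _ Sum.inl_injective, Set.ncard_univ,
      Nat.card_eq_fintype_card, hι]
    omega
end
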